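/- arXiv:1308.3728 — 4 statements merged into one kernel-verified Lean document; each statement's English description precedes it below -/
import Mathlib

section
/- Trek system determinant formula: With Σ = (I-Λ)^{-T} Ω (I-Λ)^{-1} as in the trek rule, for any X, Y ⊆ V with |X| = |Y|, det(Σ_{X,Y}) = Σ_Π (−1)^Π Π_{τ∈Π} σ(τ), where the sum is over all systems of treks Π : X ⇉ Y without sided intersection, and (−1)^Π is the sign of the permutation induced by the source-to-target bijection of Π. -/
open Matrix BigOperators

def SupportedOn {V : Type} (E : V → V → Prop) (Λ : Matrix V V ℝ) : Prop :=
  ∀ u v, ¬ E u v → Λ u v = 0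

def Acyclic {V : Type} (E : V → V → Prop) : Prop :=
  ∀ v, ¬ Relation.TransGen E v v

def cycAdj (p : ℕ) (i j : Fin p) : Prop :=
  (i.1 + 1) % p = j.1 ∨ (j.1 + 1) % p = i.1

structure Trek {V : Type} (E : V → V → Prop) (u v : V) where
  left : List V
  right : List V
  left_ne : left ≠ []
  right_ne : right ≠ []
  top_eq : left.head left_ne = right.head right_ne
  chain_left : List.Chain' E left
  chain_right : List.Chain' E right
  last_left : left.getLast left_ne = u
  last_right : right.getLast right_ne = v

def Trek.top {V : Type} {E : V → V → Prop} {u v : V} (τ : Trek E u v) : V :=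
  τ.left.head τ.left_ne

def edgeProd {V : Type} (Λ : Matrix V V ℝ) (l : List V) : ℝ :=
  ((l.zip l.tail).map fun p => Λ p.1 p.2).prod

def Trek.mono {V : Type} {E : V → V → Prop} {u v : V} (Λ Ω : Matrix V V ℝ)
    (τ : Trek E u v) : ℝ :=
  Ω τ.top τ.top * edgeProd Λ τ.left * edgeProd Λ τ.right

structure TrekSystem {V : Type} (E : V → V → Prop) {n : ℕ} (x y : Fin n → V) where
  perm : Equiv.Perm (Fin n)
  trek : ∀ i, Trek E (x i) (y (perm i))

def TrekSystem.NoSided {V : Type} {E : V → V → Prop} {n : ℕ} {x y : Fin n → V}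
    (S : TrekSystem E x y) : Prop :=
  ∀ i j, i ≠ j →
    (∀ a : V, ¬(a ∈ (S.trek i).left ∧ a ∈ (S.trek j).left)) ∧
    (∀ a : V, ¬(a ∈ (S.trek i).right ∧ a ∈ (S.trek j).right))

structure DWalk {U : Type} (E : U → U → Prop) (u v : U) where
  steps : List (Bool × U × U)
  ne : steps ≠ []
  first_eq : (steps.head ne).2.1 = u
  last_eq : (steps.getLast ne).2.2 = v
  edge : ∀ s ∈ steps, (s.1 = true → E s.2.1 s.2.2) ∧ (s.1 = false → E s.2.2 s.2.1)
  chain : List.Chain' (fun s t : Bool × U × U => s.2.2 = t.2.1) steps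

def stepPairOK {U : Type} (A : Set U) (s t : Bool × U × U) : Prop :=
  ((s.1 = true ∧ t.1 = false) → s.2.2 ∈ A) ∧ (¬(s.1 = true ∧ t.1 = false) → s.2.2 ∉ A)

def DWalk.DConn {U : Type} {E : U → U → Prop} {u v : U} (A : Set U)
    (w : DWalk E u v) : Prop :=
  List.Chain' (stepPairOK A) w.steps

def topOf {U : Type} : List (Bool × U × U) → U → U
  | [], u => u
  | (d, a, _b) :: rest, _ => if d then a else topOf rest _b

def DWalk.top {U : Type} {E : U → U → Prop} {u v : U} (w : DWalk E u v) : U :=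
  topOf w.steps u

def TopsA {U : Type} (E : U → U → Prop) (A : Set U) (u v : U) : Set U :=
  {t | ∃ w : DWalk E u v, w.DConn A ∧ w.top = t}

def anAvoid {U : Type} (E : U → U → Prop) (A : Set U) (x : U) : Set U :=
  {u | u ∉ A ∧ Relation.ReflTransGen (fun a b => E a b ∧ a ∉ A ∧ b ∉ A) u x}

def EA {U : Type} (E : U → U → Prop) (A : Set U) (n1 n2 : U) : Set (U × U) :=
  {e | E e.1 e.2 ∧ e.1 ∈ TopsA E A n1 n2 ∧ e.2 ∈ anAvoid E A n1 ∧ e.2 ∉ TopsA E A n1 n2}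

def IsProperPath {U : Type} (E : U → U → Prop) (A : Set U) (l : List U) : Prop :=
  l ≠ [] ∧ List.Chain' (fun a b => E a b ∧ a ∉ A) l

def DigraphCov {U : Type} [Fintype U] [DecidableEq U] (E : U → U → Prop) :
    Set (Matrix U U ℝ) :=
  {S | ∃ Λ Ω : Matrix U U ℝ, SupportedOn E Λ ∧ Ω.IsDiag ∧ (∀ u, 0 < Ω u u) ∧
        S = ((1 - Λ)⁻¹)ᵀ * Ω * (1 - Λ)⁻¹}

def BSupported {V : Type} (B : SimpleGraph V) (Ω : Matrix V V ℝ) : Prop :=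
  ∀ u v, u ≠ v → ¬ B.Adj u v → Ω u v = 0

def MixedCov {V : Type} [Fintype V] [DecidableEq V] (D : V → V → Prop)
    (B : SimpleGraph V) : Set (Matrix V V ℝ) :=
  {S | ∃ Λ Ω : Matrix V V ℝ, SupportedOn D Λ ∧ Ω.PosDef ∧ BSupported B Ω ∧
        S = ((1 - Λ)⁻¹)ᵀ * Ω * (1 - Λ)⁻¹}

def StrictlyGaussianCausal {V : Type} [Fintype V] [DecidableEq V]
    (D : V → V → Prop) (B : SimpleGraph V) : Prop :=
  ∃ (U : Type) (iF : Fintype U) (iD : DecidableEq U) (ι : V ↪ U) (E : U → U → Prop),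
    Acyclic E ∧
      (fun S : Matrix U U ℝ => S.submatrix ι ι) '' (@DigraphCov U iF iD E) = MixedCov D B

def Chordal {V : Type} (B : SimpleGraph V) : Prop :=
  ∀ n : ℕ, 4 ≤ n → ∀ f : ZMod n → V, Function.Injective f →
    (∀ i, B.Adj (f i) (f (i + 1))) →
    ∃ i j : ZMod n, j ≠ i + 1 ∧ i ≠ j + 1 ∧ i ≠ j ∧ B.Adj (f i) (f j)

def ChainGraph {V : Type} (D : V → V → Prop) (B : SimpleGraph V) : Prop :=
  ¬ ∃ u v, D u v ∧ Relation.ReflTransGen (fun a b => D a b ∨ B.Adj a b) v u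


namespace TrekDet

/-- `l` is a directed path (list of vertices) ending in `v`. -/
def IsP {V : Type} (E : V → V → Prop) (v : V) (l : List V) : Prop :=
  l.IsChain E ∧ l.getLast? = some v

theorem nodup_of_chain {V : Type} {E : V → V → Prop} (hE : Acyclic E) {l : List V}
    (h : l.IsChain E) : l.Nodup := by
  have h1 : l.IsChain (Relation.TransGen E) := h.imp fun a b hab => Relation.TransGen.single hab
  have h2 : l.Pairwise (Relation.TransGen E) := h1.pairwise
  exact h2.imp (by intro a b hab heq; subst heq; exact hE a hab)

theorem finite_paths {V : Type} [Fintype V] [DecidableEq V] {E : V → V → Prop} (hE : Acyclic E)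
    (v : V) : {l : List V | IsP E v l}.Finite := by
  have : ({l : List V | l.Nodup}).Finite :=
    (inferInstance : Finite {l : List V // l.Nodup})
  exact this.subset fun l hl => nodup_of_chain hE hl.1

noncomputable def paths {V : Type} [Fintype V] [DecidableEq V] {E : V → V → Prop} (hE : Acyclic E)
    (v : V) : Finset (List V) := (finite_paths hE v).toFinset

theorem mem_paths {V : Type} [Fintype V] [DecidableEq V] {E : V → V → Prop} (hE : Acyclic E)
    {v : V} {l : List V} : l ∈ paths hE v ↔ IsP E v l := by
  simp [paths]

theorem edgeProd_cons_cons {V : Type} (Λ : Matrix V V ℝ) (a b : V) (l : List V) :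
    edgeProd Λ (a :: b :: l) = Λ a b * edgeProd Λ (b :: l) := by
  simp [edgeProd]

theorem edgeProd_split {V : Type} (Λ : Matrix V V ℝ) (P : List V) (a : V) (Q : List V) :
    edgeProd Λ (P ++ a :: Q) = edgeProd Λ (P ++ [a]) * edgeProd Λ (a :: Q) := by
  induction P with
  | nil => simp [edgeProd]
  | cons p P ih =>
    cases P with
    | nil => simp [edgeProd]
    | cons q P =>
      simp only [List.cons_append] at ih ⊢
      rw [edgeProd_cons_cons, ih, edgeProd_cons_cons, mul_assoc]

theorem isP_split {V : Type} {E : V → V → Prop} {v : V} (P : List V) (a : V) (Q : List V) :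
    IsP E v (P ++ a :: Q) ↔ (P ++ [a]).IsChain E ∧ IsP E v (a :: Q) := by
  simp only [IsP]
  rw [List.isChain_split, and_assoc]
  simp [List.getLast?_append]

/-- The path matrix satisfies `B = 1 + Λ B`. -/
theorem path_matrix {V : Type} [Fintype V] [DecidableEq V] {E : V → V → Prop} (hE : Acyclic E)
    (Λ : Matrix V V ℝ) (hΛ : SupportedOn E Λ) (t v : V) :
    (1 - Λ)⁻¹ t v = ∑ l ∈ paths hE v, if l.headD v = t then edgeProd Λ l else 0 := by
  classical
  set B : Matrix V V ℝ := Matrix.of fun t v =>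
    ∑ l ∈ paths hE v, if l.headD v = t then edgeProd Λ l else 0 with hB
  suffices h : (1 - Λ) * B = 1 by
    rw [Matrix.inv_eq_right_inv h]; rfl
  suffices h : B = 1 + Λ * B by
    rw [sub_mul, one_mul]; nth_rewrite 1 [h]; simp
  ext t v
  have key : (paths hE v).filter (fun l => l.headD v = t) =
      (if t = v then {[v]} else ∅) ∪
      ((paths hE v).filter (fun l : List V => E t (l.headD v))).image (fun l => t :: l) := by
    ext l
    simp only [Finset.mem_filter, Finset.mem_union, Finset.mem_image, mem_paths]
    rcases l with _ | ⟨a, _ | ⟨b, l⟩⟩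
    · simp [IsP]
      split_ifs <;> simp
    · simp [IsP]
      split_ifs with h
      · subst h; simp; 
      · simp; grind
    · simp only [IsP, List.isChain_cons_cons]
      have : (a :: b :: l) ∉ (if t = v then {[v]} else ∅ : Finset (List V)) := by
        split_ifs <;> simp
      simp [this]
      grind
  have hdisj : Disjoint (if t = v then {[v]} else ∅ : Finset (List V))
      (((paths hE v).filter (fun l : List V => E t (l.headD v))).image (fun l => t :: l)) := by
    split_ifs
    · simp [mem_paths, IsP]
    · simp
  simp only [hB, Matrix.of_apply, Matrix.add_apply, Matrix.mul_apply]
  rw [← Finset.sum_filter, key, Finset.sum_union hdisj, Finset.sum_image (by simp)]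
  congr 1
  · rw [Matrix.one_apply]; split_ifs <;> simp [edgeProd]
  · simp_rw [Finset.mul_sum]
    rw [Finset.sum_comm, Finset.sum_filter]
    refine Finset.sum_congr rfl fun l hl => ?_
    rw [mem_paths] at hl
    rcases l with _ | ⟨a, l⟩
    · simp [IsP] at hl
    · have hs : ∑ s, Λ t s * (if (a :: l).headD v = s then edgeProd Λ (a :: l) else 0) =
          Λ t a * edgeProd Λ (a :: l) := by
        rw [Finset.sum_eq_single a]
        · simp
        · intro b _ hb
          rw [if_neg (by simpa using hb.symm), mul_zero]
        · simp
      rw [hs, edgeProd_cons_cons, List.headD_cons]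
      split_ifs with h
      · rfl
      · rw [hΛ _ _ h, zero_mul]

/-! The tail swap. -/

def up {V : Type} [DecidableEq V] (a : V) (l : List V) : List V := l.takeWhile (fun b => b ≠ a)
def dn {V : Type} [DecidableEq V] (a : V) (l : List V) : List V := l.dropWhile (fun b => b ≠ a)

theorem up_append_dn {V : Type} [DecidableEq V] (a : V) (l : List V) : up a l ++ dn a l = l :=
  List.takeWhile_append_dropWhile

theorem not_mem_up {V : Type} [DecidableEq V] (a : V) (l : List V) : a ∉ up a l := by
  intro h
  have := List.mem_takeWhile_imp h
  simp at this

theorem dn_eq {V : Type} [DecidableEq V] {a : V} {l : List V} (h : a ∈ l) :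
    ∃ Q, dn a l = a :: Q := by
  induction l with
  | nil => simp at h
  | cons b l ih =>
    by_cases hb : b = a
    · subst hb; exact ⟨l, by simp [dn]⟩
    · have : dn a (b :: l) = dn a l := by simp [dn, hb]
      rw [this]; exact ih (by simpa [Ne.symm hb] using h)

theorem up_app {V : Type} [DecidableEq V] {a : V} {P Q : List V} (h : a ∉ P) :
    up a (P ++ a :: Q) = P := by
  induction P with
  | nil => simp [up]
  | cons b P ih =>
    simp at h
    have : up a ((b :: P) ++ a :: Q) = b :: up a (P ++ a :: Q) := by
      simp [up, Ne.symm h.1]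
    rw [this, ih h.2]

theorem dn_app {V : Type} [DecidableEq V] {a : V} {P Q : List V} (h : a ∉ P) :
    dn a (P ++ a :: Q) = a :: Q := by
  have := up_append_dn a (P ++ a :: Q)
  rw [up_app h] at this
  exact List.append_cancel_left this

def tsw {V : Type} [DecidableEq V] {n : ℕ} (L : Fin n → List V) (a : V) (i j : Fin n) :
    Fin n → List V := fun k => up a (L (Equiv.swap i j k)) ++ dn a (L k)

section tsw
variable {V : Type} [DecidableEq V] {n : ℕ} {L : Fin n → List V} {a : V} {i j : Fin n}

theorem tsw_other {k : Fin n} (hi : k ≠ i) (hj : k ≠ j) : tsw L a i j k = L k := by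
  simp [tsw, Equiv.swap_apply_of_ne_of_ne hi hj, up_append_dn]

theorem tsw_mem (hi : a ∈ L i) (hj : a ∈ L j) (k : Fin n) : a ∈ tsw L a i j k ↔ a ∈ L k := by
  by_cases h1 : k = i
  · subst h1
    obtain ⟨Q, hQ⟩ := dn_eq hi
    simp [tsw, hQ, hi]
  by_cases h2 : k = j
  · subst h2
    obtain ⟨Q, hQ⟩ := dn_eq hj
    simp [tsw, hQ, hj]
  rw [tsw_other h1 h2]

theorem up_tsw (hi : a ∈ L i) (hj : a ∈ L j) (k : Fin n) :
    up a (tsw L a i j k) = up a (L (Equiv.swap i j k)) := by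
  by_cases h : a ∈ L k
  · obtain ⟨Q, hQ⟩ := dn_eq h
    simp only [tsw, hQ]
    exact up_app (not_mem_up _ _)
  · have h1 : k ≠ i := by rintro rfl; exact h hi
    have h2 : k ≠ j := by rintro rfl; exact h hj
    rw [tsw_other h1 h2, Equiv.swap_apply_of_ne_of_ne h1 h2]

theorem dn_tsw (hi : a ∈ L i) (hj : a ∈ L j) (k : Fin n) :
    dn a (tsw L a i j k) = dn a (L k) := by
  by_cases h : a ∈ L k
  · obtain ⟨Q, hQ⟩ := dn_eq h
    simp only [tsw, hQ]
    exact dn_app (not_mem_up _ _)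
  · have h1 : k ≠ i := by rintro rfl; exact h hi
    have h2 : k ≠ j := by rintro rfl; exact h hj
    rw [tsw_other h1 h2]

theorem tsw_tsw (hi : a ∈ L i) (hj : a ∈ L j) : tsw (tsw L a i j) a i j = L := by
  funext k
  have : tsw (tsw L a i j) a i j k =
    up a (tsw L a i j (Equiv.swap i j k)) ++ dn a (tsw L a i j k) := rfl
  rw [this, up_tsw hi hj, dn_tsw hi hj, Equiv.swap_apply_self, up_append_dn]

theorem swap_mem (hi : a ∈ L i) (hj : a ∈ L j) (k : Fin n) :
    a ∈ L (Equiv.swap i j k) ↔ a ∈ L k := by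
  by_cases h1 : k = i
  · subst h1; simp [hi, hj]
  by_cases h2 : k = j
  · subst h2; simp [hi, hj]
  rw [Equiv.swap_apply_of_ne_of_ne h1 h2]

theorem isP_iff {E : V → V → Prop} {v : V} {l : List V} (h : a ∈ l) :
    IsP E v l ↔ (up a l ++ [a]).IsChain E ∧ IsP E v (dn a l) := by
  obtain ⟨Q, hQ⟩ := dn_eq h
  conv_lhs => rw [← up_append_dn a l, hQ]
  rw [isP_split, hQ]

theorem tsw_isP {E : V → V → Prop} {x : Fin n → V} (hi : a ∈ L i) (hj : a ∈ L j)
    (h : ∀ k, IsP E (x k) (L k)) (k : Fin n) : IsP E (x k) (tsw L a i j k) := by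
  by_cases hk : a ∈ L k
  · rw [isP_iff ((tsw_mem hi hj k).2 hk), up_tsw hi hj, dn_tsw hi hj]
    exact ⟨((isP_iff ((swap_mem hi hj k).2 hk)).1 (h _)).1, ((isP_iff hk).1 (h k)).2⟩
  · have h1 : k ≠ i := by rintro rfl; exact hk hi
    have h2 : k ≠ j := by rintro rfl; exact hk hj
    rw [tsw_other h1 h2]; exact h k

theorem headD_eq {l : List V} (h : a ∈ l) (v : V) : l.headD v = (up a l ++ [a]).headD v := by
  obtain ⟨Q, hQ⟩ := dn_eq h
  conv_lhs => rw [← up_append_dn a l, hQ]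
  cases up a l <;> simp

theorem headD_congr {l : List V} (h : a ∈ l) (v w : V) : l.headD v = l.headD w := by
  cases l <;> simp at *

theorem tsw_head {x : Fin n → V} (hi : a ∈ L i) (hj : a ∈ L j) (k : Fin n) :
    (tsw L a i j k).headD (x k) =
      (L (Equiv.swap i j k)).headD (x (Equiv.swap i j k)) := by
  by_cases hk : a ∈ L k
  · rw [headD_eq ((tsw_mem hi hj k).2 hk), up_tsw hi hj,
      headD_congr ((swap_mem hi hj k).2 hk) _ (x k), headD_eq ((swap_mem hi hj k).2 hk)]
  · have h1 : k ≠ i := by rintro rfl; exact hk hi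
    have h2 : k ≠ j := by rintro rfl; exact hk hj
    rw [tsw_other h1 h2, Equiv.swap_apply_of_ne_of_ne h1 h2]

theorem edgeProd_eq (Λ : Matrix V V ℝ) {l : List V} (h : a ∈ l) :
    edgeProd Λ l = edgeProd Λ (up a l ++ [a]) * edgeProd Λ (dn a l) := by
  obtain ⟨Q, hQ⟩ := dn_eq h
  conv_lhs => rw [← up_append_dn a l, hQ]
  rw [edgeProd_split, hQ]

theorem tsw_prod (Λ : Matrix V V ℝ) (hi : a ∈ L i) (hj : a ∈ L j) :
    ∏ k, edgeProd Λ (tsw L a i j k) = ∏ k, edgeProd Λ (L k) := by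
  let f : Fin n → ℝ := fun k => if a ∈ L k then edgeProd Λ (up a (L k) ++ [a]) else 1
  let g : Fin n → ℝ := fun k => if a ∈ L k then edgeProd Λ (dn a (L k)) else edgeProd Λ (L k)
  have h1 : ∀ k, edgeProd Λ (L k) = f k * g k := by
    intro k
    by_cases hk : a ∈ L k
    · simp [f, g, hk, edgeProd_eq Λ hk]
    · simp [f, g, hk]
  have h2 : ∀ k, edgeProd Λ (tsw L a i j k) = f (Equiv.swap i j k) * g k := by
    intro k
    by_cases hk : a ∈ L k
    · rw [edgeProd_eq Λ ((tsw_mem hi hj k).2 hk), up_tsw hi hj, dn_tsw hi hj]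
      simp [f, g, hk, swap_mem hi hj k]
    · have h1 : k ≠ i := by rintro rfl; exact hk hi
      have h2 : k ≠ j := by rintro rfl; exact hk hj
      rw [tsw_other h1 h2, Equiv.swap_apply_of_ne_of_ne h1 h2]
      simp [f, g, hk]
  simp_rw [h1, h2, Finset.prod_mul_distrib]
  rw [Equiv.prod_comp (Equiv.swap i j) f]

/-- Vertex `b` is shared by two different lists. -/
def Sh (L : Fin n → List V) (b : V) : Prop := ∃ k l, k ≠ l ∧ b ∈ L k ∧ b ∈ L l

theorem tsw_sh (hn : ∀ k, (tsw L a i j k).Nodup) {b : V}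
    (h : Sh L b) : Sh (tsw L a i j) b := by
  obtain ⟨k, l, hkl, hk, hl⟩ := h
  have hup : ∀ k, b ∈ up a (L k) → b ∈ tsw L a i j (Equiv.swap i j k) := by
    intro k hk; simp [tsw, hk]
  have hdn : ∀ k, b ∈ dn a (L k) → b ∈ tsw L a i j k := by
    intro k hk; simp [tsw, hk]
  have hmix : ∀ k l, b ∈ up a (L k) → b ∈ dn a (L l) → Equiv.swap i j k ≠ l := by
    rintro k l hk hl rfl
    have := hn (Equiv.swap i j k)
    rw [tsw, Equiv.swap_apply_self] at this
    exact (List.disjoint_of_nodup_append this) hk hl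
  rw [← up_append_dn a (L k), List.mem_append] at hk
  rw [← up_append_dn a (L l), List.mem_append] at hl
  rcases hk with hk | hk <;> rcases hl with hl | hl
  · exact ⟨_, _, fun h => hkl ((Equiv.swap i j).injective h), hup _ hk, hup _ hl⟩
  · exact ⟨_, _, hmix _ _ hk hl, hup _ hk, hdn _ hl⟩
  · exact ⟨_, _, (hmix _ _ hl hk).symm, hdn _ hk, hup _ hl⟩
  · exact ⟨_, _, hkl, hdn _ hk, hdn _ hl⟩

end tsw

open Classical in
/-- The signed sum over intersecting path systems vanishes. -/
theorem cancel {V : Type} [Fintype V] [DecidableEq V] {E : V → V → Prop} (hE : Acyclic E)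
    (Λ : Matrix V V ℝ) {n : ℕ} (x : Fin n → V) (F : (Fin n → V) → ℝ)
    (hF : ∀ h i j, i ≠ j → F (fun k => h (Equiv.swap i j k)) = - F h) :
    ∑ L ∈ Fintype.piFinset (fun i => paths hE (x i)),
        (∏ i, edgeProd Λ (L i)) * F (fun i => (L i).headD (x i)) =
    ∑ L ∈ (Fintype.piFinset (fun i => paths hE (x i))).filter (fun L => ∀ b, ¬ Sh L b),
        (∏ i, edgeProd Λ (L i)) * F (fun i => (L i).headD (x i)) := by
  rw [← Finset.sum_filter_add_sum_filter_not _ (fun L : Fin n → List V => ∀ b, ¬ Sh L b)]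
  rw [add_eq_left]
  by_cases hne : Nonempty V ∧ Nonempty (Fin n)
  swap
  · refine Finset.sum_eq_zero fun L hL => ?_
    simp only [Finset.mem_filter, not_forall, not_not] at hL
    obtain ⟨-, b, i, -⟩ := hL
    exact (hne ⟨⟨b⟩, ⟨i⟩⟩).elim
  obtain ⟨hV, hn⟩ := hne
  let pa : (V → Prop) → V := fun p => Classical.epsilon p
  let pq : (Fin n → Prop) → Fin n × Fin n :=
    fun p => Classical.epsilon (fun q : Fin n × Fin n => q.1 ≠ q.2 ∧ p q.1 ∧ p q.2)
  have hpa : ∀ L : Fin n → List V, (∃ b, Sh L b) → Sh L (pa (Sh L)) :=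
    fun L h => Classical.epsilon_spec h
  have hpq : ∀ p : Fin n → Prop, (∃ k l, k ≠ l ∧ p k ∧ p l) →
      (pq p).1 ≠ (pq p).2 ∧ p (pq p).1 ∧ p (pq p).2 := by
    intro p ⟨k, l, h⟩
    exact Classical.epsilon_spec (p := fun q : Fin n × Fin n => q.1 ≠ q.2 ∧ p q.1 ∧ p q.2)
      ⟨(k, l), h⟩
  let aa : (Fin n → List V) → V := fun L => pa (Sh L)
  let qq : (Fin n → List V) → Fin n × Fin n := fun L => pq (fun k => aa L ∈ L k)
  have hq : ∀ L : Fin n → List V, (∃ b, Sh L b) →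
      (qq L).1 ≠ (qq L).2 ∧ aa L ∈ L (qq L).1 ∧ aa L ∈ L (qq L).2 :=
    fun L h => hpq _ (hpa L h)
  let g : (Fin n → List V) → (Fin n → List V) := fun L => tsw L (aa L) (qq L).1 (qq L).2
  have hmem : ∀ L, L ∈ (Fintype.piFinset (fun i => paths hE (x i))).filter
      (fun L => ¬ ∀ b, ¬ Sh L b) ↔ (∀ k, IsP E (x k) (L k)) ∧ ∃ b, Sh L b := by
    intro L
    simp [mem_paths]
  have hgP : ∀ L, (∃ b, Sh L b) → (∀ k, IsP E (x k) (L k)) → ∀ k, IsP E (x k) (g L k) :=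
    fun L hL h => tsw_isP (hq L hL).2.1 (hq L hL).2.2 h
  have hgS : ∀ L, (∃ b, Sh L b) → (∀ k, IsP E (x k) (L k)) → Sh (g L) = Sh L := by
    intro L hL h
    funext b
    refine propext ⟨fun hb => ?_, fun hb => ?_⟩
    · have := tsw_tsw (hq L hL).2.1 (hq L hL).2.2
      rw [← this]
      refine tsw_sh (fun k => ?_) hb
      rw [this]; exact nodup_of_chain hE (h k).1
    · exact tsw_sh (fun k => nodup_of_chain hE (hgP L hL h k).1) hb
  have hgg : ∀ L, (∃ b, Sh L b) → (∀ k, IsP E (x k) (L k)) → g (g L) = L := by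
    intro L hL h
    have e1 : aa (g L) = aa L := by simp only [aa, hgS L hL h]
    have e2 : qq (g L) = qq L := by
      have e3 : (fun k => aa L ∈ g L k) = (fun k => aa L ∈ L k) :=
        funext fun k => propext (tsw_mem (hq L hL).2.1 (hq L hL).2.2 k)
      simp only [qq, e1]
      exact congrArg pq e3
    have : g (g L) = tsw (g L) (aa (g L)) (qq (g L)).1 (qq (g L)).2 := rfl
    rw [this, e1, e2]
    exact tsw_tsw (hq L hL).2.1 (hq L hL).2.2
  have hsum : ∀ L, (∃ b, Sh L b) →
      (∏ i, edgeProd Λ (L i)) * F (fun i => (L i).headD (x i)) +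
      (∏ i, edgeProd Λ (g L i)) * F (fun i => (g L i).headD (x i)) = 0 := by
    intro L hL
    obtain ⟨h0, h1, h2⟩ := hq L hL
    have e1 : (fun i => (g L i).headD (x i)) = fun k =>
        (fun i => (L i).headD (x i)) (Equiv.swap (qq L).1 (qq L).2 k) :=
      funext fun k => tsw_head h1 h2 k
    rw [e1, hF (fun i => (L i).headD (x i)) _ _ h0, tsw_prod Λ h1 h2]
    ring
  refine Finset.sum_involution (fun L _ => g L) ?_ ?_ ?_ ?_
  · intro L hL
    exact hsum L ((hmem L).1 hL).2
  · intro L hL hf heq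
    have := hsum L ((hmem L).1 hL).2
    rw [heq] at this
    exact hf (by linarith)
  · intro L hL
    obtain ⟨h1, h2⟩ := (hmem L).1 hL
    rw [hmem, hgS L h2 h1]
    exact ⟨hgP L h2 h1, h2⟩
  · intro L hL
    obtain ⟨h1, h2⟩ := (hmem L).1 hL
    exact hgg L h2 h1

/-- Row expansion of a determinant whose rows are sums over paths. -/
theorem det_expand {V : Type} {n : ℕ} (P : Fin n → Finset (List V)) (c : List V → ℝ)
    (x : Fin n → V) (M : V → Fin n → ℝ) :
    (Matrix.of fun i j => ∑ l ∈ P i, c l * M (l.headD (x i)) j).det =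
    ∑ L ∈ Fintype.piFinset P,
      (∏ i, c (L i)) * (Matrix.of fun i j => M ((L i).headD (x i)) j).det := by
  classical
  have h1 : (Matrix.of fun i j => ∑ l ∈ P i, c l * M (l.headD (x i)) j) =
      fun i => ∑ l ∈ P i, c l • M (l.headD (x i)) := by
    funext i j
    simp
  have h2 := (Matrix.detRowAlternating (n := Fin n) (R := ℝ)).toMultilinearMap.map_sum_finset
    (fun i l => c l • M (l.headD (x i))) P
  rw [h1]
  refine h2.trans (Finset.sum_congr rfl fun L _ => ?_)
  have h3 := (Matrix.detRowAlternating (n := Fin n) (R := ℝ)).toMultilinearMap.map_smul_univ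
    (fun i => c (L i)) (fun i => M ((L i).headD (x i)))
  exact h3

theorem path_sum {V : Type} [Fintype V] [DecidableEq V] {E : V → V → Prop} (hE : Acyclic E)
    (Λ : Matrix V V ℝ) (hΛ : SupportedOn E Λ) (v : V) (f : V → ℝ) :
    ∑ t, (1 - Λ)⁻¹ t v * f t = ∑ l ∈ paths hE v, edgeProd Λ l * f (l.headD v) := by
  simp_rw [path_matrix hE Λ hΛ, Finset.sum_mul]
  rw [Finset.sum_comm]
  refine Finset.sum_congr rfl fun l _ => ?_
  simp [ite_mul]

theorem det_swap_rows {n : ℕ} {V : Type} (M : V → Fin n → ℝ) (h : Fin n → V) (i j : Fin n)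
    (hij : i ≠ j) :
    (Matrix.of fun k l => M (h (Equiv.swap i j k)) l).det =
      - (Matrix.of fun k l => M (h k) l).det := by
  have := Matrix.det_permute (Equiv.swap i j) (Matrix.of fun k l => M (h k) l)
  rw [Equiv.Perm.sign_swap hij] at this
  simpa [Matrix.submatrix] using this

open Classical in
noncomputable def NP {V : Type} [Fintype V] [DecidableEq V] {E : V → V → Prop} (hE : Acyclic E)
    {n : ℕ} (x : Fin n → V) : Finset (Fin n → List V) :=
  (Fintype.piFinset (fun i => paths hE (x i))).filter (fun L => ∀ b, ¬ Sh L b)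

theorem mem_NP {V : Type} [Fintype V] [DecidableEq V] {E : V → V → Prop} (hE : Acyclic E)
    {n : ℕ} (x : Fin n → V) (L : Fin n → List V) :
    L ∈ NP hE x ↔ (∀ i, IsP E (x i) (L i)) ∧ ∀ b, ¬ Sh L b := by
  simp [NP, mem_paths]

theorem det_main {V : Type} [Fintype V] [DecidableEq V] {E : V → V → Prop} (hE : Acyclic E)
    (Λ Ω : Matrix V V ℝ) (hΛ : SupportedOn E Λ) {n : ℕ} (x y : Fin n → V) :
    (Matrix.of fun i j : Fin n => (((1 - Λ)⁻¹)ᵀ * Ω * (1 - Λ)⁻¹ : Matrix V V ℝ) (x i) (y j)).det =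
    ∑ L ∈ NP hE x, (∏ i, edgeProd Λ (L i)) * ∑ R ∈ NP hE y, (∏ i, edgeProd Λ (R i)) *
      (Matrix.of fun j i => Ω ((L i).headD (x i)) ((R j).headD (y j))).det := by
  classical
  have e1 : (Matrix.of fun i j : Fin n => (((1 - Λ)⁻¹)ᵀ * Ω * (1 - Λ)⁻¹ : Matrix V V ℝ) (x i) (y j)) =
      Matrix.of fun i j => ∑ l ∈ paths hE (x i), edgeProd Λ l *
        (fun (t : V) (j : Fin n) => (Ω * (1 - Λ)⁻¹) t (y j)) (l.headD (x i)) j := by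
    ext i j
    simp only [Matrix.of_apply]
    rw [← path_sum hE Λ hΛ (x i) (fun t => (Ω * (1 - Λ)⁻¹) t (y j)), Matrix.mul_assoc,
      Matrix.mul_apply]
    rfl
  refine (congrArg Matrix.det e1).trans ((det_expand (fun i => paths hE (x i)) (edgeProd Λ) x
    (fun (t : V) (j : Fin n) => (Ω * (1 - Λ)⁻¹) t (y j))).trans ?_)
  refine Eq.trans (cancel hE Λ x (fun h => (Matrix.of fun i j => (Ω * (1 - Λ)⁻¹) (h i) (y j)).det)
    (fun h i j hij => det_swap_rows (fun t j => (Ω * (1 - Λ)⁻¹) t (y j)) h i j hij)) ?_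
  refine Finset.sum_congr rfl fun L _ => ?_
  congr 1
  rw [← Matrix.det_transpose]
  have e2 : (Matrix.of fun i j : Fin n => (Ω * (1 - Λ)⁻¹) ((L i).headD (x i)) (y j))ᵀ =
      Matrix.of fun j i => ∑ l ∈ paths hE (y j), edgeProd Λ l *
        (fun (t : V) (i : Fin n) => Ω ((L i).headD (x i)) t) (l.headD (y j)) i := by
    ext j i
    simp only [Matrix.of_apply, Matrix.transpose_apply]
    rw [← path_sum hE Λ hΛ (y j) (fun t => Ω ((L i).headD (x i)) t), Matrix.mul_apply]
    exact Finset.sum_congr rfl fun t _ => mul_comm _ _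
  refine (congrArg Matrix.det e2).trans ((det_expand (fun i => paths hE (y i)) (edgeProd Λ) y
    (fun (t : V) (i : Fin n) => Ω ((L i).headD (x i)) t)).trans ?_)
  exact cancel hE Λ y (fun h => (Matrix.of fun j i => Ω ((L i).headD (x i)) (h j)).det)
    (fun h i j hij => det_swap_rows (fun t i => Ω ((L i).headD (x i)) t) h i j hij)

theorem trek_ext {V : Type} {E : V → V → Prop} {u v : V} {s t : Trek E u v}
    (h1 : s.left = t.left) (h2 : s.right = t.right) : s = t := by
  cases s; cases t; cases h1; cases h2; rfl

open Classical in
noncomputable def K {V : Type} [Fintype V] [DecidableEq V] {E : V → V → Prop} (hE : Acyclic E)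
    {n : ℕ} (x y : Fin n → V) :
    Finset ((Fin n → List V) × (Fin n → List V) × Equiv.Perm (Fin n)) :=
  (NP hE x ×ˢ (NP hE y ×ˢ Finset.univ)).filter fun c =>
    ∀ i, (c.1 i).headD (x i) = (c.2.1 (c.2.2 i)).headD (y (c.2.2 i))

theorem mem_K {V : Type} [Fintype V] [DecidableEq V] {E : V → V → Prop} (hE : Acyclic E)
    {n : ℕ} (x y : Fin n → V)
    (c : (Fin n → List V) × (Fin n → List V) × Equiv.Perm (Fin n)) :
    c ∈ K hE x y ↔ (c.1 ∈ NP hE x ∧ c.2.1 ∈ NP hE y) ∧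
      ∀ i, (c.1 i).headD (x i) = (c.2.1 (c.2.2 i)).headD (y (c.2.2 i)) := by
  simp [K]

theorem headD_head {V : Type} (l : List V) (h : l ≠ []) (v : V) : l.headD v = l.head h := by
  cases l with
  | nil => exact absurd rfl h
  | cons a l => rfl

theorem IsP.ne_nil {V : Type} {E : V → V → Prop} {v : V} {l : List V} (h : IsP E v l) :
    l ≠ [] := by
  rintro rfl; simp [IsP] at h

theorem IsP.getLast_eq {V : Type} {E : V → V → Prop} {v : V} {l : List V} (h : IsP E v l) :
    l.getLast h.ne_nil = v := by
  have := h.2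
  rw [List.getLast?_eq_some_getLast h.ne_nil] at this
  exact Option.some.inj this

theorem isP_left {V : Type} {E : V → V → Prop} {u v : V} (t : Trek E u v) : IsP E u t.left :=
  ⟨t.chain_left, by rw [List.getLast?_eq_some_getLast t.left_ne, t.last_left]⟩

theorem isP_right {V : Type} {E : V → V → Prop} {u v : V} (t : Trek E u v) : IsP E v t.right :=
  ⟨t.chain_right, by rw [List.getLast?_eq_some_getLast t.right_ne, t.last_right]⟩

theorem isP_right' {V : Type} {E : V → V → Prop} {n : ℕ} {x y : Fin n → V}
    (T : TrekSystem E x y) (j : Fin n) : IsP E (y j) (T.trek (T.perm.symm j)).right := by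
  have := isP_right (T.trek (T.perm.symm j))
  have h2 : y (T.perm (T.perm.symm j)) = y j := by rw [Equiv.apply_symm_apply]
  exact (congrArg (fun v => IsP E v (T.trek (T.perm.symm j)).right) h2).mp this

theorem right_symm {V : Type} {E : V → V → Prop} {n : ℕ} {x y : Fin n → V}
    (p : Equiv.Perm (Fin n)) (t : ∀ i, Trek E (x i) (y (p i))) (i : Fin n) :
    (t (p.symm (p i))).right = (t i).right :=
  congrArg (fun k => (t k).right) (p.symm_apply_apply i)

noncomputable def trekEquiv {V : Type} [Fintype V] [DecidableEq V] {E : V → V → Prop}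
    (hE : Acyclic E) {n : ℕ} (x y : Fin n → V) :
    {T : TrekSystem E x y // T.NoSided} ≃ {c // c ∈ K hE x y} where
  toFun T := ⟨(fun i => (T.1.trek i).left, fun j => (T.1.trek (T.1.perm.symm j)).right, T.1.perm),
    by
      obtain ⟨T, hT⟩ := T
      rw [mem_K, mem_NP, mem_NP]
      refine ⟨⟨⟨fun i => isP_left _, ?_⟩, fun j => isP_right' T j, ?_⟩, ?_⟩
      · rintro b ⟨k, l, hkl, h1, h2⟩
        exact (hT k l hkl).1 b ⟨h1, h2⟩
      · rintro b ⟨k, l, hkl, h1, h2⟩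
        exact (hT _ _ (fun h => hkl (T.perm.symm.injective h))).2 b ⟨h1, h2⟩
      · intro i
        simp only [right_symm]
        rw [headD_head _ (T.trek i).left_ne, headD_head _ (T.trek i).right_ne]
        exact (T.trek i).top_eq⟩
  invFun c := ⟨⟨c.1.2.2, fun i =>
      have hc := (mem_K hE x y c.1).1 c.2
      have hl : IsP E (x i) (c.1.1 i) := ((mem_NP hE x _).1 hc.1.1).1 i
      have hr : IsP E (y (c.1.2.2 i)) (c.1.2.1 (c.1.2.2 i)) := ((mem_NP hE y _).1 hc.1.2).1 _
      { left := c.1.1 i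
        right := c.1.2.1 (c.1.2.2 i)
        left_ne := hl.ne_nil
        right_ne := hr.ne_nil
        top_eq := by
          rw [← headD_head _ hl.ne_nil (x i), ← headD_head _ hr.ne_nil (y (c.1.2.2 i))]
          exact hc.2 i
        chain_left := hl.1
        chain_right := hr.1
        last_left := hl.getLast_eq
        last_right := hr.getLast_eq }⟩, by
      have hc := (mem_K hE x y c.1).1 c.2
      have h1 := ((mem_NP hE x _).1 hc.1.1).2
      have h2 := ((mem_NP hE y _).1 hc.1.2).2
      intro i j hij
      exact ⟨fun a ha => h1 a ⟨i, j, hij, ha.1, ha.2⟩,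
        fun a ha => h2 a ⟨_, _, fun h => hij (c.1.2.2.injective h), ha.1, ha.2⟩⟩⟩
  left_inv := by
    rintro ⟨⟨p, t⟩, hT⟩
    apply Subtype.ext
    simp only [TrekSystem.mk.injEq, heq_eq_eq, true_and]
    funext i
    refine trek_ext rfl ?_
    exact right_symm p t i
  right_inv := by
    rintro ⟨⟨L, R, p⟩, hc⟩
    apply Subtype.ext
    simp

end TrekDet

theorem stmt3 {V : Type} [Fintype V] [DecidableEq V] (E : V → V → Prop)
    (hE : Acyclic E) (Λ Ω : Matrix V V ℝ)
    (hΛ : SupportedOn E Λ) (hΩd : Ω.IsDiag) (hΩp : ∀ v, 0 < Ω v v)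
    (S : Matrix V V ℝ) (hS : S = ((1 - Λ)⁻¹)ᵀ * Ω * (1 - Λ)⁻¹)
    {n : ℕ} (x y : Fin n → V) (hx : Function.Injective x) (hy : Function.Injective y) :
    Finite {T : TrekSystem E x y // T.NoSided} ∧
      (Matrix.of fun i j : Fin n =>
          S (x i) (y j)).det =
        ∑ᶠ T : {T : TrekSystem E x y // T.NoSided},
          ((Equiv.Perm.sign T.1.perm : ℤ) : ℝ) * ∏ i, (T.1.trek i).mono Λ Ω := by
  have := hx
  have := hy
  have := hΩp
  classical
  let e := TrekDet.trekEquiv hE x y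
  refine ⟨Finite.of_equiv _ e.symm, ?_⟩
  rw [hS, TrekDet.det_main hE Λ Ω hΛ x y]
  let G : (Fin n → List V) × (Fin n → List V) × Equiv.Perm (Fin n) → ℝ := fun c =>
    (∏ i, edgeProd Λ (c.1 i)) * ((∏ i, edgeProd Λ (c.2.1 i)) *
      (((Equiv.Perm.sign c.2.2 : ℤ) : ℝ) *
        ∏ i, Ω ((c.1 i).headD (x i)) ((c.2.1 (c.2.2 i)).headD (y (c.2.2 i)))))
  have hR : (∑ᶠ T : {T : TrekSystem E x y // T.NoSided},
      ((Equiv.Perm.sign T.1.perm : ℤ) : ℝ) * ∏ i, (T.1.trek i).mono Λ Ω) =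
      ∑ᶠ c : {c // c ∈ TrekDet.K hE x y}, G c.1 := by
    refine finsum_eq_of_bijective e e.bijective fun T => ?_
    have hT := ((TrekDet.mem_K hE x y _).1 (e T).2).2
    have hG : G (e T).1 = (∏ i, edgeProd Λ (T.1.trek i).left) *
        ((∏ j, edgeProd Λ (T.1.trek (T.1.perm.symm j)).right) *
          (((Equiv.Perm.sign T.1.perm : ℤ) : ℝ) *
        ∏ i, Ω (T.1.trek i).top (T.1.trek i).top)) := by
      simp only [G, ← hT]
      have : ∀ i, ((e T).1.1 i).headD (x i) = (T.1.trek i).top :=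
        fun i => TrekDet.headD_head _ (T.1.trek i).left_ne _
      simp only [this]
      rfl
    rw [hG, Equiv.prod_comp T.1.perm.symm (fun i => edgeProd Λ (T.1.trek i).right)]
    simp only [Trek.mono, Finset.prod_mul_distrib]
    ring
  rw [hR, finsum_eq_sum_of_fintype, Finset.sum_coe_sort (TrekDet.K hE x y) G, TrekDet.K,
    Finset.sum_filter_of_ne, Finset.sum_product]
  · refine Finset.sum_congr rfl fun L _ => ?_
    rw [Finset.sum_product, Finset.mul_sum]
    refine Finset.sum_congr rfl fun R _ => ?_
    rw [Matrix.det_apply', Finset.mul_sum, Finset.mul_sum]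
    rfl
  · intro c _ hc i
    by_contra hne
    refine hc ?_
    have : ∏ i, Ω ((c.1 i).headD (x i)) ((c.2.1 (c.2.2 i)).headD (y (c.2.2 i))) = 0 :=
      Finset.prod_eq_zero (Finset.mem_univ i) (hΩd hne)
    simp only [G, this, mul_zero]
end

section
/- There exists a system of treks without sided intersection from X to Y in an acyclic digraph D if and only if det(Σ_{X,Y}) ≠ 0 for the covariance matrix Σ of some distribution in the Gaussian model N(D). -/
open Matrix BigOperators

theorem exists_rank {V : Type} [Fintype V] (E : V → V → Prop) (hE : Acyclic E) :
    ∃ r : V → ℕ, Function.Injective r ∧ ∀ u v, E u v → r u < r v := by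
  classical
  let po : PartialOrder V :=
    { le := Relation.ReflTransGen E
      le_refl := fun a => Relation.ReflTransGen.refl
      le_trans := fun a b c h1 h2 => h1.trans h2
      le_antisymm := by
        intro a b h1 h2
        rcases Relation.reflTransGen_iff_eq_or_transGen.1 h1 with h | h
        · exact h.symm
        · exact absurd (h.trans_left h2) (hE a) }
  let f : V → LinearExtension V := fun v => toLinearExtension v
  have fi : Function.Injective f := fun a b h => h
  haveI : Fintype (LinearExtension V) := (inferInstance : Fintype V)
  let e : LinearExtension V ≃o Fin (Fintype.card (LinearExtension V)) :=
    (Fintype.orderIsoFinOfCardEq _ rfl).symm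
  refine ⟨fun v => (e (f v)).1, ?_, ?_⟩
  · intro a b h
    exact fi (e.injective (Fin.ext h))
  · intro u v huv
    have hle : f u ≤ f v := toLinearExtension.monotone (Relation.ReflTransGen.single huv)
    have hne : f u ≠ f v := by
      intro h
      have : u = v := fi h
      subst this
      exact hE u (Relation.TransGen.single huv)
    have : f u < f v := lt_of_le_of_ne hle hne
    exact e.strictMono this

theorem det_one_sub {V : Type} [Fintype V] [DecidableEq V] {E : V → V → Prop}
    {r : V → ℕ} (hri : Function.Injective r) (hr : ∀ u v, E u v → r u < r v)
    {R : Type} [CommRing R] (Λ : Matrix V V R) (hΛ : ∀ u v, ¬ E u v → Λ u v = 0) :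
    (1 - Λ).det = 1 := by
  letI : LinearOrder V := LinearOrder.lift' r hri
  have hlt : ∀ a b : V, a < b ↔ r a < r b := fun a b => Iff.rfl
  have h0 : ∀ a b : V, ¬ r a < r b → Λ a b = 0 := fun a b h => hΛ a b (fun h' => h (hr _ _ h'))
  have hbt : (1 - Λ).BlockTriangular id := by
    intro i j hij
    have hij' : r j < r i := hij
    have hne : i ≠ j := by rintro rfl; exact lt_irrefl _ hij'
    simp [Matrix.one_apply_ne hne, h0 i j (by omega)]
  have := Matrix.det_of_isUpperTriangular hbt
  convert this using 1
  symm
  apply Finset.prod_eq_one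
  intro i _
  simp [h0 i i (lt_irrefl _)]

theorem reach {V : Type} [Fintype V] [DecidableEq V] {E : V → V → Prop}
    {r : V → ℕ} (hri : Function.Injective r) (hr : ∀ u v, E u v → r u < r v)
    {n : ℕ} (Λ : Matrix V V ℝ) (hΛ : SupportedOn E Λ) (B C : Matrix (Fin n) V ℝ)
    (hC : C = B + C * Λ) :
    ∀ (N : ℕ) (F : Finset (Fin n)) (x : Fin n → V),
      (∀ i ∈ F, ∀ j, j ∉ F → r (x j) < r (x i)) →
      (∑ i ∈ Fᶜ, (r (x i) + 1)) < N →
      (Matrix.of fun k i : Fin n => if i ∈ F then B k (x i) else C k (x i)).det ≠ 0 →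
      ∃ (t : Fin n → V) (p : Fin n → List V),
        (∀ i, (p i).IsChain E) ∧ (∀ i, (p i).head? = some (t i)) ∧
        (∀ i, (p i).getLast? = some (x i)) ∧
        (∀ i ∈ F, p i = [x i]) ∧ (∀ i, ∀ a ∈ p i, r a ≤ r (x i)) ∧
        (∀ i j, i ≠ j → ∀ a, ¬ (a ∈ p i ∧ a ∈ p j)) ∧
        (Matrix.of fun k i : Fin n => B k (t i)).det ≠ 0 := by
  intro N
  induction N with
  | zero => intro F x _ h; exact absurd h (Nat.not_lt_zero _)
  | succ N ih =>
    intro F x hF hN hdet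
    set M := (Matrix.of fun k i : Fin n => if i ∈ F then B k (x i) else C k (x i)) with hM
    have hinj : ∀ i j, i ≠ j → x i ≠ x j := by
      intro i j hij hx
      by_cases hi : i ∈ F <;> by_cases hj : j ∈ F
      · exact hdet (Matrix.det_zero_of_column_eq hij (by intro k; simp [hM, hi, hj, hx]))
      · have := hF i hi j hj; rw [hx] at this; exact lt_irrefl _ this
      · have := hF j hj i hi; rw [hx] at this; exact lt_irrefl _ this
      · exact hdet (Matrix.det_zero_of_column_eq hij (by intro k; simp [hM, hi, hj, hx]))
    by_cases hne : (Fᶜ).Nonempty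
    · obtain ⟨i0, hi0, hmax⟩ := Finset.exists_max_image Fᶜ (fun i => r (x i)) hne
      have hi0' : i0 ∉ F := by simpa using hi0
      have hlt : ∀ j, j ∉ F → j ≠ i0 → r (x j) < r (x i0) := by
        intro j hj hji
        refine lt_of_le_of_ne (hmax j (by simpa using hj)) ?_
        intro h
        exact hinj j i0 hji (hri h)
      have hcol : M.det = (M.updateCol i0 (fun k => B k (x i0))).det +
          ∑ w, Λ w (x i0) * (M.updateCol i0 (fun k => C k w)).det := by
        have h1 : M = M.updateCol i0 ((fun k => B k (x i0)) +
            ∑ w, Λ w (x i0) • (fun k => C k w)) := by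
          ext k i
          by_cases h : i = i0
          · subst h
            have h2 : C k (x i) = B k (x i) + ∑ w, C k w * Λ w (x i) := by
              conv_lhs => rw [hC]
              simp [Matrix.add_apply, Matrix.mul_apply]
            simp [hM, hi0', h2, Finset.sum_apply, mul_comm]
          · simp [Matrix.updateCol_ne h]
        conv_lhs => rw [h1]
        rw [← Matrix.cramer_apply, map_add, map_sum]
        simp [Matrix.cramer_apply, Finset.sum_apply]
      by_cases hB : (M.updateCol i0 (fun k => B k (x i0))).det = 0
      · rw [hB, zero_add] at hcol
        obtain ⟨w, -, hw⟩ := Finset.exists_ne_zero_of_sum_ne_zero (hcol ▸ hdet)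
        have hE : E w (x i0) := by
          by_contra h
          exact hw (by rw [hΛ _ _ h, zero_mul])
        have hrw := hr _ _ hE
        have hd := right_ne_zero_of_mul hw
        obtain ⟨t, p, h1, h2, h3, h4, h5, h6, h7⟩ := ih F (Function.update x i0 w) (by
            intro i hi j hj
            have hii : i ≠ i0 := by rintro rfl; exact hi0' hi
            rw [Function.update_of_ne hii]
            by_cases hjj : j = i0
            · subst hjj
              rw [Function.update_self]
              exact hrw.trans (hF i hi j hj)
            · rw [Function.update_of_ne hjj]
              exact hF i hi j hj) (by
            refine lt_of_lt_of_le (Finset.sum_lt_sum (s := Fᶜ)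
              (g := fun i => r (x i) + 1) ?_ ⟨i0, hi0, ?_⟩) (Nat.lt_succ_iff.1 hN)
            · intro i _
              by_cases h : i = i0
              · subst h; simp; omega
              · simp [Function.update_of_ne h]
            · simpa using hrw) (by
            convert hd using 2
            ext k i
            by_cases h : i = i0
            · subst h; simp [hi0']
            · simp [Matrix.updateCol_ne h, Function.update_of_ne h, hM])
        have hnot : ∀ j, j ≠ i0 → x i0 ∉ p j := by
          intro j hj hmem
          by_cases hjF : j ∈ F
          · rw [h4 j hjF, Function.update_of_ne hj] at hmem
            simp at hmem
            exact hinj j i0 hj hmem.symm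
          · have := h5 j _ hmem
            rw [Function.update_of_ne hj] at this
            have := hlt j hjF hj
            omega
        refine ⟨t, Function.update p i0 (p i0 ++ [x i0]), ?_, ?_, ?_, ?_, ?_, ?_, h7⟩
        · intro i
          by_cases h : i = i0
          · subst h
            rw [Function.update_self, List.isChain_append]
            refine ⟨h1 i, by simp, ?_⟩
            intro a ha b hb
            rw [h3 i, Function.update_self] at ha
            simp at ha hb
            subst ha; subst hb
            exact hE
          · rw [Function.update_of_ne h]; exact h1 i
        · intro i
          by_cases h : i = i0
          · subst h
            rw [Function.update_self, List.head?_append, h2 i]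
            rfl
          · rw [Function.update_of_ne h]; exact h2 i
        · intro i
          by_cases h : i = i0
          · subst h
            simp
          · rw [Function.update_of_ne h, h3 i, Function.update_of_ne h]
        · intro i hi
          have h : i ≠ i0 := by rintro rfl; exact hi0' hi
          rw [Function.update_of_ne h, h4 i hi, Function.update_of_ne h]
        · intro i a ha
          by_cases h : i = i0
          · subst h
            rw [Function.update_self, List.mem_append] at ha
            rcases ha with ha | ha
            · have := h5 i a ha
              rw [Function.update_self] at this
              omega
            · simp at ha; rw [ha]
          · rw [Function.update_of_ne h] at ha
            have := h5 i a ha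
            rwa [Function.update_of_ne h] at this
        · intro i j hij a ⟨hai, haj⟩
          by_cases h : i = i0
          · subst h
            rw [Function.update_self, List.mem_append] at hai
            rw [Function.update_of_ne hij.symm] at haj
            rcases hai with hai | hai
            · exact h6 i j hij a ⟨hai, haj⟩
            · simp at hai; subst hai
              exact hnot j hij.symm haj
          · rw [Function.update_of_ne h] at hai
            by_cases h' : j = i0
            · subst h'
              rw [Function.update_self, List.mem_append] at haj
              rcases haj with haj | haj
              · exact h6 i j hij a ⟨hai, haj⟩
              · simp at haj; subst haj
                exact hnot i hij hai
            · rw [Function.update_of_ne h'] at haj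
              exact h6 i j hij a ⟨hai, haj⟩
      · obtain ⟨t, p, h1, h2, h3, h4, h5, h6, h7⟩ := ih (insert i0 F) x (by
            intro i hi j hj
            simp at hi hj
            rcases hi with rfl | hi
            · exact hlt j hj.2 hj.1
            · exact hF i hi j hj.2) (by
            have h := Finset.add_sum_erase Fᶜ (fun i => r (x i) + 1) hi0
            rw [Finset.compl_insert]
            omega) (by
            convert hB using 2
            ext k i
            by_cases h : i = i0
            · subst h; simp
            · simp [hM, h])
        exact ⟨t, p, h1, h2, h3, fun i hi => h4 i (Finset.mem_insert_of_mem hi), h5, h6, h7⟩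
    · have hall : ∀ i, i ∈ F := by
        intro i; by_contra h; exact hne ⟨i, by simpa using h⟩
      refine ⟨x, fun i => [x i], by simp, by simp, by simp, by simp, by simp, ?_, ?_⟩
      · intro i j hij a ⟨h1, h2⟩
        simp at h1 h2
        exact hinj i j hij (h1.symm.trans h2)
      · simpa [hM, hall] using hdet

theorem reach' {V : Type} [Fintype V] [DecidableEq V] {E : V → V → Prop}
    {r : V → ℕ} (hri : Function.Injective r) (hr : ∀ u v, E u v → r u < r v)
    {n : ℕ} (Λ : Matrix V V ℝ) (hΛ : SupportedOn E Λ) (B : Matrix (Fin n) V ℝ)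
    (x : Fin n → V)
    (h : (Matrix.of fun k i : Fin n => (B * (1 - Λ)⁻¹) k (x i)).det ≠ 0) :
      ∃ (t : Fin n → V) (p : Fin n → List V),
        (∀ i, (p i).IsChain E) ∧ (∀ i, (p i).head? = some (t i)) ∧
        (∀ i, (p i).getLast? = some (x i)) ∧
        (∀ i j, i ≠ j → ∀ a, ¬ (a ∈ p i ∧ a ∈ p j)) ∧
        (Matrix.of fun k i : Fin n => B k (t i)).det ≠ 0 := by
  have hd := det_one_sub hri hr Λ hΛ
  have hC : B * (1 - Λ)⁻¹ = B + (B * (1 - Λ)⁻¹) * Λ := by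
    have h1 : (1 - Λ)⁻¹ * (1 - Λ) = 1 := Matrix.nonsing_inv_mul _ (by rw [hd]; exact isUnit_one)
    have h2 : (1 - Λ)⁻¹ = 1 + (1 - Λ)⁻¹ * Λ := by
      rw [mul_sub, mul_one] at h1
      exact sub_eq_iff_eq_add.1 h1
    conv_lhs => rw [h2]
    rw [Matrix.mul_add, Matrix.mul_one, Matrix.mul_assoc]
  obtain ⟨t, p, h1, h2, h3, -, -, h6, h7⟩ := reach hri hr Λ hΛ B _ hC _ ∅ x (by simp)
    (Nat.lt_succ_self _) (by simpa using h)
  exact ⟨t, p, h1, h2, h3, h6, h7⟩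

theorem direction_one {V : Type} [Fintype V] [DecidableEq V] (E : V → V → Prop)
    (hE : Acyclic E) {n : ℕ} (x y : Fin n → V) (Λ Ω : Matrix V V ℝ)
    (hΛ : SupportedOn E Λ) (hΩ : Ω.IsDiag)
    (h : (Matrix.of fun i j : Fin n =>
      (((1 - Λ)⁻¹)ᵀ * Ω * (1 - Λ)⁻¹ : Matrix V V ℝ) (x i) (y j)).det ≠ 0) :
    ∃ S : TrekSystem E x y, S.NoSided := by
  obtain ⟨r, hri, hr⟩ := exists_rank E hE
  obtain ⟨t, q, q1, q2, q3, q4, q5⟩ := reach' hri hr Λ hΛ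
    (Matrix.of fun i v => (((1 - Λ)⁻¹)ᵀ * Ω : Matrix V V ℝ) (x i) v) y (by
      convert h using 2
      ext i j
      simp only [Matrix.of_apply, Matrix.mul_apply])
  obtain ⟨s, p, p1, p2, p3, p4, p5⟩ := reach' hri hr Λ hΛ
    (Matrix.of fun i v => Ω v (t i)) x (by
      rw [← Matrix.det_transpose]
      convert q5 using 2
      ext i k
      simp only [Matrix.transpose_apply, Matrix.of_apply, Matrix.mul_apply]
      exact Finset.sum_congr rfl fun v _ => mul_comm _ _)
  -- some permutation contributes to the last determinant
  rw [Matrix.det_apply] at p5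
  obtain ⟨σ, -, hσ⟩ := Finset.exists_ne_zero_of_sum_ne_zero p5
  have hσ' : ∀ i, s i = t (σ i) := by
    intro i
    by_contra hne
    apply hσ
    rw [Finset.prod_eq_zero (Finset.mem_univ i), smul_zero]
    simpa using hΩ hne
  have hpne : ∀ i, p i ≠ [] := fun i h => by have := p2 i; simp [h] at this
  have hqne : ∀ i, q i ≠ [] := fun i h => by have := q2 i; simp [h] at this
  refine ⟨⟨σ, fun i => ⟨p i, q (σ i), hpne i, hqne _, ?_, p1 i, q1 _, ?_, ?_⟩⟩, ?_⟩
  · have a := p2 i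
    have b := q2 (σ i)
    rw [List.head?_eq_some_head (hpne i)] at a
    rw [List.head?_eq_some_head (hqne _)] at b
    rw [Option.some.inj a, Option.some.inj b, hσ' i]
  · have a := p3 i
    rw [List.getLast?_eq_some_getLast (hpne i)] at a
    exact Option.some.inj a
  · have a := q3 (σ i)
    rw [List.getLast?_eq_some_getLast (hqne _)] at a
    exact Option.some.inj a
  · intro i j hij
    exact ⟨p4 i j hij, q4 _ _ (fun h => hij (σ.injective h))⟩

open Classical in
/-- The indicator matrix of the edges used by a family of paths. -/
noncomputable def pathMat {V : Type} {n : ℕ} (p : Fin n → List V) : Matrix V V ℝ :=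
  Matrix.of fun u v => if ∃ i k, (p i)[k]? = some u ∧ (p i)[k + 1]? = some v then 1 else 0

theorem pathMat_supported {V : Type} {E : V → V → Prop} {n : ℕ} (p : Fin n → List V)
    (hp : ∀ i, (p i).IsChain E) : SupportedOn E (pathMat p) := by
  intro u v huv
  have : ¬ ∃ i k, (p i)[k]? = some u ∧ (p i)[k + 1]? = some v := by
    rintro ⟨i, k, h1, h2⟩
    obtain ⟨hk, rfl⟩ := List.getElem?_eq_some_iff.1 h1
    obtain ⟨hk', rfl⟩ := List.getElem?_eq_some_iff.1 h2
    exact huv (List.isChain_iff_getElem.1 (hp i) k hk')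
  simp [pathMat, this]

theorem chain_nodup {V : Type} {E : V → V → Prop}
    {r : V → ℕ} (hr : ∀ u v, E u v → r u < r v) (l : List V) (hl : l.IsChain E) : l.Nodup := by
  haveI : IsTrans V (fun u v => r u < r v) := ⟨fun a b c h1 h2 => lt_trans h1 h2⟩
  have h2 : l.IsChain (fun u v => r u < r v) := hl.imp (fun a b h => hr a b h)
  have h3 := List.isChain_iff_pairwise.1 h2
  exact h3.imp (fun {a b} h => by rintro rfl; exact lt_irrefl _ h)

open Classical in
theorem path_inverse {V : Type} [Fintype V] [DecidableEq V] {E : V → V → Prop}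
    {r : V → ℕ} (hri : Function.Injective r) (hr : ∀ u v, E u v → r u < r v)
    {n : ℕ} (t : Fin n → V) (p : Fin n → List V) (hp : ∀ i, (p i).IsChain E)
    (ht : ∀ i, (p i).head? = some (t i))
    (hd : ∀ i j, i ≠ j → ∀ a, ¬ (a ∈ p i ∧ a ∈ p j)) (i : Fin n) (v : V) :
    (1 - pathMat p)⁻¹ (t i) v = if v ∈ p i then 1 else 0 := by
  have hdet := det_one_sub hri hr (pathMat p) (pathMat_supported p hp)
  have hnd : ∀ i, (p i).Nodup := fun i => chain_nodup hr _ (hp i)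
  let F : Matrix (Fin n) V ℝ := Matrix.of fun i v => if v ∈ p i then 1 else 0
  let T : Matrix (Fin n) V ℝ := Matrix.of fun i v => if t i = v then 1 else 0
  have ht0 : ∀ i, (p i)[0]? = some (t i) := fun i => by rw [← List.head?_eq_getElem?]; exact ht i
  have key : F * (1 - pathMat p) = T := by
    rw [Matrix.mul_sub, Matrix.mul_one]
    ext i v
    rw [Matrix.sub_apply, Matrix.mul_apply]
    by_cases hv : ∃ k, (p i)[k + 1]? = some v
    · obtain ⟨k, hk⟩ := hv
      obtain ⟨hk', hkv⟩ := List.getElem?_eq_some_iff.1 hk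
      have hvm : v ∈ p i := List.mem_of_getElem? hk
      have hne : t i ≠ v := by
        intro h
        have h0 := ht0 i
        rw [h, ← hk] at h0
        have := (List.getElem?_inj (by omega) (hnd i)).1 h0
        omega
      rw [Finset.sum_eq_single ((p i)[k])]
      · have h1 : ∃ i' k', (p i')[k']? = some ((p i)[k]) ∧ (p i')[k' + 1]? = some v :=
          ⟨i, k, List.getElem?_eq_getElem _, hk⟩
        simp only [F, T, pathMat, Matrix.of_apply]
        rw [if_pos hvm, if_pos (List.getElem_mem _), if_pos h1, if_neg hne]
        norm_num
      · intro a _ ha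
        by_cases h : ∃ i' k', (p i')[k']? = some a ∧ (p i')[k' + 1]? = some v
        · exfalso
          obtain ⟨i', k', e1, e2⟩ := h
          have hii : i' = i := by
            by_contra hne'
            exact hd i' i hne' v ⟨List.mem_of_getElem? e2, hvm⟩
          subst hii
          rw [← hk] at e2
          have hkk := (List.getElem?_inj (by omega) (hnd i')).1 e2.symm
          have : k = k' := by omega
          subst this
          rw [List.getElem?_eq_getElem (by omega)] at e1
          exact ha (Option.some.inj e1).symm
        · simp only [pathMat, Matrix.of_apply]
          rw [if_neg h, mul_zero]
      · simp
    · have hs : ∑ a, F i a * pathMat p a v = 0 := by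
        apply Finset.sum_eq_zero
        intro a _
        by_cases ha : a ∈ p i
        · have h : ¬ ∃ i' k', (p i')[k']? = some a ∧ (p i')[k' + 1]? = some v := by
            rintro ⟨i', k', e1, e2⟩
            have hii : i' = i := by
              by_contra hne'
              exact hd i' i hne' a ⟨List.mem_of_getElem? e1, ha⟩
            subst hii
            exact hv ⟨k', e2⟩
          simp only [pathMat, Matrix.of_apply]
          rw [if_neg h, mul_zero]
        · simp only [F, Matrix.of_apply]
          rw [if_neg ha, zero_mul]
      rw [hs, sub_zero]
      have : v ∈ p i ↔ t i = v := by
        constructor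
        · intro h
          obtain ⟨k, hk⟩ := List.mem_iff_getElem?.1 h
          cases k with
          | zero => rw [ht0 i] at hk; exact Option.some.inj hk
          | succ k => exact absurd ⟨k, hk⟩ hv
        · rintro rfl
          exact List.mem_of_getElem? (ht0 i)
      simp only [F, T, Matrix.of_apply, this]
  have hF : F = T * (1 - pathMat p)⁻¹ := by
    rw [← key, Matrix.mul_assoc, Matrix.mul_nonsing_inv _ (by rw [hdet]; exact isUnit_one),
      Matrix.mul_one]
  have := congrFun (congrFun hF i) v
  rw [Matrix.mul_apply] at this
  simp only [F, T, Matrix.of_apply] at this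
  rw [this]
  simp

theorem path_det {V : Type} [Fintype V] [DecidableEq V] {E : V → V → Prop}
    {r : V → ℕ} (hri : Function.Injective r) (hr : ∀ u v, E u v → r u < r v)
    {n : ℕ} (t x : Fin n → V) (p : Fin n → List V) (hp : ∀ i, (p i).IsChain E)
    (ht : ∀ i, (p i).head? = some (t i)) (hx : ∀ i, (p i).getLast? = some (x i))
    (hd : ∀ i j, i ≠ j → ∀ a, ¬ (a ∈ p i ∧ a ∈ p j)) :
    (Matrix.of fun i j => (1 - pathMat p)⁻¹ (t i) (x j)).det ≠ 0 := by
  classical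
  have hxm : ∀ i, x i ∈ p i := fun i => List.mem_of_getLast? (hx i)
  have : (Matrix.of fun i j => (1 - pathMat p)⁻¹ (t i) (x j)) = 1 := by
    ext i j
    rw [Matrix.of_apply, path_inverse hri hr t p hp ht hd]
    by_cases h : i = j
    · subst h; simp [hxm]
    · rw [Matrix.one_apply_ne h, if_neg]
      intro h'
      exact hd i j h _ ⟨h', hxm j⟩
  rw [this]; simp

open Polynomial in
theorem combine {V : Type} [Fintype V] [DecidableEq V] {E : V → V → Prop}
    {r : V → ℕ} (hri : Function.Injective r) (hr : ∀ u v, E u v → r u < r v)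
    {n : ℕ} (t x y : Fin n → V) (Λ₁ Λ₂ : Matrix V V ℝ)
    (h₁ : SupportedOn E Λ₁) (h₂ : SupportedOn E Λ₂)
    (d₁ : (Matrix.of fun i j => (1 - Λ₁)⁻¹ (t i) (x j)).det ≠ 0)
    (d₂ : (Matrix.of fun i j => (1 - Λ₂)⁻¹ (t i) (y j)).det ≠ 0) :
    ∃ Λ : Matrix V V ℝ, SupportedOn E Λ ∧
      (Matrix.of fun i j => (1 - Λ)⁻¹ (t i) (x j)).det ≠ 0 ∧
      (Matrix.of fun i j => (1 - Λ)⁻¹ (t i) (y j)).det ≠ 0 := by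
  let L : Matrix V V ℝ[X] := Matrix.of fun u v => C (Λ₁ u v) + X * C (Λ₂ u v - Λ₁ u v)
  let Λs : ℝ → Matrix V V ℝ := fun s => Matrix.of fun u v => Λ₁ u v + s * (Λ₂ u v - Λ₁ u v)
  have hsup : ∀ s, SupportedOn E (Λs s) := by
    intro s u v huv
    simp [Λs, h₁ u v huv, h₂ u v huv]
  have hinv : ∀ s, (1 - Λs s)⁻¹ = (1 - Λs s).adjugate := by
    intro s
    rw [Matrix.inv_def, det_one_sub hri hr _ (hsup s)]
    simp
  have hev : ∀ s, (1 - L).map (evalRingHom s) = 1 - Λs s := by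
    intro s
    ext u v
    by_cases h : u = v
    · subst h; simp [L, Λs]
    · simp [L, Λs, Matrix.one_apply_ne h]
  let f : (Fin n → V) → ℝ[X] := fun z =>
    (Matrix.of fun i j => (1 - L).adjugate (t i) (z j)).det
  have hf : ∀ z s, (f z).eval s = (Matrix.of fun i j => (1 - Λs s)⁻¹ (t i) (z j)).det := by
    intro z s
    rw [← coe_evalRingHom, RingHom.map_det]
    congr 1
    ext i j
    rw [hinv, ← hev, ← RingHom.mapMatrix_apply, ← RingHom.map_adjugate]
    rfl
  have e0 : Λs 0 = Λ₁ := by ext; simp [Λs]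
  have e1 : Λs 1 = Λ₂ := by ext; simp [Λs]
  have f1 : f x ≠ 0 := by
    intro h
    have := hf x 0
    rw [h, e0, eval_zero] at this
    exact d₁ this.symm
  have f2 : f y ≠ 0 := by
    intro h
    have := hf y 1
    rw [h, e1, eval_zero] at this
    exact d₂ this.symm
  obtain ⟨s, hs⟩ : ∃ s, (f x * f y).eval s ≠ 0 := by
    by_contra! h
    exact mul_ne_zero f1 f2 (Polynomial.funext (by simpa using h))
  rw [eval_mul, hf, hf] at hs
  exact ⟨Λs s, hsup s, left_ne_zero_of_mul hs, right_ne_zero_of_mul hs⟩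

open Classical in
theorem direction_two {V : Type} [Fintype V] [DecidableEq V] (E : V → V → Prop)
    (hE : Acyclic E) {n : ℕ} (x y : Fin n → V)
    (S : TrekSystem E x y) (hS : S.NoSided) :
    ∃ Λ Ω : Matrix V V ℝ, SupportedOn E Λ ∧ Ω.IsDiag ∧ (∀ u, 0 < Ω u u) ∧
      (Matrix.of fun i j : Fin n =>
        (((1 - Λ)⁻¹)ᵀ * Ω * (1 - Λ)⁻¹ : Matrix V V ℝ) (x i) (y j)).det ≠ 0 := by
  obtain ⟨r, hri, hr⟩ := exists_rank E hE
  let t : Fin n → V := fun i => (S.trek i).top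
  let y' : Fin n → V := fun i => y (S.perm i)
  let p : Fin n → List V := fun i => (S.trek i).left
  let q : Fin n → List V := fun i => (S.trek i).right
  have hp : ∀ i, (p i).IsChain E := fun i => (S.trek i).chain_left
  have hq : ∀ i, (q i).IsChain E := fun i => (S.trek i).chain_right
  have hpt : ∀ i, (p i).head? = some (t i) := fun i =>
    List.head?_eq_some_head (S.trek i).left_ne
  have hqt : ∀ i, (q i).head? = some (t i) := fun i => by
    rw [List.head?_eq_some_head (S.trek i).right_ne]
    exact congrArg some (S.trek i).top_eq.symm
  have hpx : ∀ i, (p i).getLast? = some (x i) := fun i => by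
    rw [List.getLast?_eq_some_getLast (S.trek i).left_ne]
    exact congrArg some (S.trek i).last_left
  have hqy : ∀ i, (q i).getLast? = some (y' i) := fun i => by
    rw [List.getLast?_eq_some_getLast (S.trek i).right_ne]
    exact congrArg some (S.trek i).last_right
  have hpd : ∀ i j, i ≠ j → ∀ a, ¬ (a ∈ p i ∧ a ∈ p j) := fun i j h => (hS i j h).1
  have hqd : ∀ i j, i ≠ j → ∀ a, ¬ (a ∈ q i ∧ a ∈ q j) := fun i j h => (hS i j h).2
  have htinj : Function.Injective t := by
    intro i j h
    by_contra hij
    refine hpd i j hij (t i) ⟨List.mem_of_head? (hpt i), ?_⟩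
    rw [h]; exact List.mem_of_head? (hpt j)
  obtain ⟨Λ, hΛ, dx, dy⟩ := combine hri hr t x y' _ _ (pathMat_supported p hp)
    (pathMat_supported q hq) (path_det hri hr t x p hp hpt hpx hpd)
    (path_det hri hr t y' q hq hqt hqy hqd)
  set P := (1 - Λ)⁻¹ with hP
  let ω : ℝ → V → ℝ := fun ε v => if v ∈ Set.range t then 1 else ε
  let G : ℝ → Matrix (Fin n) (Fin n) ℝ := fun ε => Matrix.of fun i j =>
    (Pᵀ * Matrix.diagonal (ω ε) * P : Matrix V V ℝ) (x i) (y j)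
  have hG : ∀ ε i j, G ε i j = ∑ v, P v (x i) * ω ε v * P v (y j) := by
    intro ε i j
    simp only [G, Matrix.of_apply]
    rw [Matrix.mul_apply]
    simp only [Matrix.mul_diagonal, Matrix.transpose_apply]
  have hcont : Continuous fun ε => (G ε).det := by
    apply Continuous.matrix_det
    apply continuous_matrix
    intro i j
    simp only [hG]
    refine continuous_finsetSum _ fun v _ => ?_
    refine (continuous_const.mul ?_).mul continuous_const
    by_cases h : v ∈ Set.range t
    · simp only [ω, if_pos h]; exact continuous_const
    · simp only [ω, if_neg h]; exact continuous_id
  have h0 : (G 0).det ≠ 0 := by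
    have hsub : (G 0).submatrix id S.perm =
        (Matrix.of fun i j => P (t i) (x j))ᵀ * (Matrix.of fun i j => P (t i) (y' j)) := by
      ext i j
      rw [Matrix.submatrix_apply, hG, Matrix.mul_apply]
      simp only [Matrix.transpose_apply, Matrix.of_apply, id]
      symm
      rw [← Finset.sum_subset (Finset.subset_univ (Finset.univ.image t)),
        Finset.sum_image (fun a _ b _ h => htinj h)]
      · refine Finset.sum_congr rfl fun k _ => ?_
        simp [ω, y']
      · intro v _ hv
        have : v ∉ Set.range t := by simpa using hv
        simp only [ω, if_neg this, mul_zero, zero_mul]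
    have hdet := Matrix.det_permute' S.perm (G 0)
    rw [hsub, Matrix.det_mul, Matrix.det_transpose] at hdet
    intro h
    rw [h, mul_zero] at hdet
    exact mul_ne_zero dx dy hdet
  have hev : ∀ᶠ ε in nhdsWithin (0 : ℝ) (Set.Ioi 0), (G ε).det ≠ 0 :=
    (hcont.continuousAt.eventually_ne h0).filter_mono nhdsWithin_le_nhds
  obtain ⟨ε, hε, hpos⟩ := (hev.and self_mem_nhdsWithin).exists
  refine ⟨Λ, Matrix.diagonal (ω ε), hΛ, Matrix.isDiag_diagonal _, ?_, hε⟩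
  intro u
  rw [Matrix.diagonal_apply_eq]
  by_cases h : u ∈ Set.range t
  · simp only [ω, if_pos h]; exact one_pos
  · simp only [ω, if_neg h]; exact hpos

theorem stmt4 {V : Type} [Fintype V] [DecidableEq V] (E : V → V → Prop)
    (hE : Acyclic E) {n : ℕ} (x y : Fin n → V)
    (hx : Function.Injective x) (hy : Function.Injective y) :
    (∃ S : TrekSystem E x y, S.NoSided) ↔
      ∃ (Λ Ω S : Matrix V V ℝ), SupportedOn E Λ ∧ Ω.IsDiag ∧ (∀ u, 0 < Ω u u) ∧
        S = ((1 - Λ)⁻¹)ᵀ * Ω * (1 - Λ)⁻¹ ∧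
        (Matrix.of fun i j : Fin n => S (x i) (y j)).det ≠ 0 := by
  constructor
  · rintro ⟨S, hS⟩
    obtain ⟨Λ, Ω, h1, h2, h3, h4⟩ := direction_two E hE x y S hS
    exact ⟨Λ, Ω, _, h1, h2, h3, rfl, h4⟩
  · rintro ⟨Λ, Ω, S, h1, h2, _, rfl, h4⟩
    exact direction_one E hE x y Λ Ω h1 h2 h4
end

section
/- If an acyclic mixed graph G = (V,D,B) has decomposable bidirected part (V,B), then G is strictly Gaussian causal: there exists an acyclic digraph D' = (U,E) with U ⊇ V (namely the clique digraph of G) such that the hidden variable model N_V(D') equals the mixed graph model N(G). -/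
open Matrix BigOperators

/-- There is a walk of length `m` from `a` to `b` with all interior vertices in `C`. -/
def WalkThru {V : Type} (B : SimpleGraph V) (C : V → Prop) (a b : V) (m : ℕ) (p : ℕ → V) : Prop :=
  p 0 = a ∧ p m = b ∧ (∀ i, i < m → B.Adj (p i) (p (i + 1))) ∧ (∀ i, 0 < i → i < m → C (p i))

lemma exists_walkThru {V : Type} (B : SimpleGraph V) (C : V → Prop) (r : V → V → Prop)
    (hr : ∀ u v, r u v → B.Adj u v) (a c b c' : V) (hac : B.Adj a c) (hbc : B.Adj b c')
    (hC : ∀ d, Relation.ReflTransGen r c d → C d)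
    (h : Relation.ReflTransGen r c c') : ∃ m p, WalkThru B C a b m p := by
  have key : ∃ (m : ℕ) (p : ℕ → V), p 0 = a ∧ p (m + 1) = c' ∧
      (∀ i, i < m + 1 → B.Adj (p i) (p (i + 1))) ∧ (∀ i, 0 < i → i ≤ m + 1 → C (p i)) := by
    clear hbc
    induction h with
    | refl =>
      refine ⟨0, fun i => if i = 0 then a else c, by simp, by simp, ?_, ?_⟩
      · intro i hi
        obtain rfl : i = 0 := by omega
        simpa using hac
      · intro i h1 _
        have : i ≠ 0 := by omega
        simpa [this] using hC c .refl
    | @tail d e hcd hde ih =>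
      obtain ⟨m, p, h0, hm, hadj, hCp⟩ := ih
      refine ⟨m + 1, fun i => if i ≤ m + 1 then p i else e, by simp [h0], by simp, ?_, ?_⟩
      · intro i hi
        by_cases h1 : i ≤ m
        · have h2 : i ≤ m + 1 := by omega
          simpa [h1, h2] using hadj i (by omega)
        · obtain rfl : i = m + 1 := by omega
          simpa [hm] using hr _ _ hde
      · intro i h1 h2
        by_cases h3 : i ≤ m + 1
        · simpa [h3] using hCp i h1 h3
        · simpa [h3] using hC e (hcd.tail hde)
  obtain ⟨m, p, h0, hm, hadj, hCp⟩ := key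
  refine ⟨m + 2, fun i => if i ≤ m + 1 then p i else b, by simp [h0], by simp, ?_, ?_⟩
  · intro i hi
    by_cases h1 : i ≤ m
    · have h2 : i ≤ m + 1 := by omega
      simpa [h1, h2] using hadj i (by omega)
    · obtain rfl : i = m + 1 := by omega
      simpa [hm] using hbc.symm
  · intro i h1 h2
    have h3 : i ≤ m + 1 := by omega
    simpa [h3] using hCp i h1 h3

/-- Two neighbours of `x` joined by a walk through non-neighbours of `x` are adjacent. -/
lemma adj_of_walkThru {V : Type} (B : SimpleGraph V) (hch : Chordal B) (C : V → Prop)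
    (a b x : V) (hab : a ≠ b) (hxa : B.Adj x a) (hxb : B.Adj x b)
    (hC : ∀ c, C c → c ≠ x ∧ ¬ B.Adj x c) (h : ∃ m p, WalkThru B C a b m p) : B.Adj a b := by
  classical
  by_contra hnab
  let m := Nat.find h
  obtain ⟨p, h0, hm, hadj, hCp⟩ : ∃ p, WalkThru B C a b m p := Nat.find_spec h
  have hmin : ∀ k, k < m → ∀ q, ¬ WalkThru B C a b k q := fun k hk q hq =>
    Nat.find_min h hk ⟨q, hq⟩
  clear_value m
  have hm2 : 2 ≤ m := by
    rcases m with _ | _ | m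
    · exact absurd (h0.symm.trans hm) hab
    · have := hadj 0 (by omega)
      simp only [zero_add] at this hm
      rw [h0, hm] at this
      exact absurd this hnab
    · omega
  -- cutting out a piece
  have cut : ∀ i j, i < j → j ≤ m → p i = p j → False := by
    intro i j hij hj he
    refine hmin (m - (j - i)) (by omega) (fun k => if k ≤ i then p k else p (k + (j - i))) ?_
    refine ⟨by simp [h0], ?_, ?_, ?_⟩
    · by_cases h1 : m - (j - i) ≤ i
      · have h2 : j = m := by omega
        have h3 : m - (j - i) = i := by omega
        simp only [h3, le_refl, if_true]
        rw [he, h2, hm]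
      · simp only [h1, if_false]
        rw [← hm]; congr 1; omega
    · intro k hk
      by_cases h1 : k + 1 ≤ i
      · have h2 : k ≤ i := by omega
        simpa only [h1, h2, if_true] using hadj k (by omega)
      · by_cases h2 : k ≤ i
        · obtain rfl : k = i := by omega
          simp only [h1, le_refl, if_true, if_false]
          have := hadj j (by omega)
          rw [he]
          convert this using 2
          omega
        · simp only [h1, h2, if_false]
          have := hadj (k + (j - i)) (by omega)
          convert this using 2
          omega
    · intro k hk hk'
      by_cases h2 : k ≤ i
      · simp only [h2, if_true]; exact hCp k hk (by omega)
      · simp only [h2, if_false]; exact hCp _ (by omega) (by omega)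
  have short : ∀ i j, i + 1 < j → j ≤ m → B.Adj (p i) (p j) → False := by
    intro i j hij hj he
    refine hmin (m - (j - i - 1)) (by omega)
      (fun k => if k ≤ i then p k else p (k + (j - i - 1))) ?_
    refine ⟨by simp [h0], ?_, ?_, ?_⟩
    · have h1 : ¬ m - (j - i - 1) ≤ i := by omega
      simp only [h1, if_false]
      rw [← hm]; congr 1; omega
    · intro k hk
      by_cases h1 : k + 1 ≤ i
      · have h2 : k ≤ i := by omega
        simpa only [h1, h2, if_true] using hadj k (by omega)
      · by_cases h2 : k ≤ i
        · obtain rfl : k = i := by omega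
          simp only [h1, le_refl, if_true, if_false]
          convert he using 2
          omega
        · simp only [h1, h2, if_false]
          have := hadj (k + (j - i - 1)) (by omega)
          convert this using 2
          omega
    · intro k hk hk'
      by_cases h2 : k ≤ i
      · simp only [h2, if_true]; exact hCp k hk (by omega)
      · simp only [h2, if_false]; exact hCp _ (by omega) (by omega)
  have hpx : ∀ i, i ≤ m → p i ≠ x := by
    intro i hi
    rcases Nat.eq_zero_or_pos i with rfl | hi0
    · rw [h0]; exact hxa.ne'
    · rcases Nat.lt_or_ge i m with h1 | h1
      · exact (hC _ (hCp i hi0 h1)).1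
      · obtain rfl : i = m := by omega
        rw [hm]; exact hxb.ne'
  have hpadj : ∀ i, i ≤ m → B.Adj x (p i) → i = 0 ∨ i = m := by
    intro i hi hx
    by_contra hcon
    push Not at hcon
    exact (hC _ (hCp i (by omega) (by omega))).2 hx
  let f : ℕ → V := fun i => if i ≤ m then p i else x
  have fle : ∀ i, i ≤ m → f i = p i := fun i hi => by simp [f, hi]
  have fx : f (m + 1) = x := by simp [f]
  have finj : ∀ i j, i < j → j ≤ m + 1 → f i ≠ f j := by
    intro i j hij hj he
    rcases Nat.lt_or_ge j (m + 1) with h1 | h1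
    · rw [fle i (by omega), fle j (by omega)] at he
      exact cut i j hij (by omega) he
    · obtain rfl : j = m + 1 := by omega
      rw [fle i (by omega), fx] at he
      exact hpx i (by omega) he
  have fchord : ∀ i j, i < j → j ≤ m + 1 → B.Adj (f i) (f j) →
      j = i + 1 ∨ (i = 0 ∧ j = m + 1) := by
    intro i j hij hj he
    rcases Nat.lt_or_ge j (m + 1) with h1 | h1
    · rw [fle i (by omega), fle j (by omega)] at he
      by_contra hcon
      exact short i j (by omega) (by omega) he
    · obtain rfl : j = m + 1 := by omega
      rw [fle i (by omega), fx] at he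
      rcases hpadj i (by omega) he.symm with h | h
      · omega
      · omega
  have hvl : ∀ i : ZMod (m + 2), i.val ≤ m + 1 := fun i => by
    have := ZMod.val_lt i; omega
  have hsucc : ∀ i j : ZMod (m + 2), j.val = i.val + 1 → j = i + 1 := by
    intro i j hij
    have := congrArg (Nat.cast : ℕ → ZMod (m + 2)) hij
    simpa using this
  have hlast : ∀ i j : ZMod (m + 2), i.val = 0 → j.val = m + 1 → i = j + 1 := by
    intro i j hi hj
    have h1 := congrArg (Nat.cast : ℕ → ZMod (m + 2)) hi
    have h2 := congrArg (Nat.cast : ℕ → ZMod (m + 2)) hj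
    have h3 : ((m + 2 : ℕ) : ZMod (m + 2)) = 0 := ZMod.natCast_self _
    simp only [ZMod.natCast_val, ZMod.cast_id', id, Nat.cast_zero] at h1 h2
    rw [h1, h2, ← h3]
    push_cast
    ring
  obtain ⟨i, j, h1, h2, h3, h4⟩ := hch (m + 2) (by omega) (fun i => f i.val) (by
      intro i j hij
      apply ZMod.val_injective
      rcases Nat.lt_trichotomy i.val j.val with h | h | h
      · exact absurd hij (finj _ _ h (hvl j))
      · exact h
      · exact absurd hij.symm (finj _ _ h (hvl i))) (by
      intro i
      show B.Adj (f i.val) (f (i + 1).val)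
      have hi := hvl i
      by_cases hlt : i.val = m + 1
      · have : i + 1 = 0 := (hlast 0 i (ZMod.val_zero) hlt).symm
        rw [this, ZMod.val_zero, hlt, fx, fle 0 (by omega), h0]
        exact hxa
      · have : (i + 1).val = i.val + 1 := by
          have : Fact (1 < m + 2) := ⟨by omega⟩
          rw [ZMod.val_add_of_lt]
          · rw [ZMod.val_one]
          · rw [ZMod.val_one]; omega
        rw [this]
        by_cases hlt2 : i.val = m
        · rw [hlt2, fx, fle m le_rfl, hm]; exact hxb.symm
        · rw [fle _ (by omega), fle _ (by omega)]
          exact hadj _ (by omega))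
  rcases Nat.lt_trichotomy i.val j.val with h | h | h
  · rcases fchord _ _ h (hvl j) h4 with h5 | ⟨h5, h6⟩
    · exact h1 (hsucc _ _ h5)
    · exact h2 (hlast _ _ h5 h6)
  · exact h3 (ZMod.val_injective _ h)
  · rcases fchord _ _ h (hvl i) h4.symm with h5 | ⟨h5, h6⟩
    · exact h2 (hsucc _ _ h5)
    · exact h1 (hlast _ _ h5 h6)

/-- `v` is simplicial in the subgraph induced on `S`. -/
def SimplicialIn {V : Type} (B : SimpleGraph V) (S : Finset V) (v : V) : Prop :=
  v ∈ S ∧ ∀ a ∈ S, ∀ b ∈ S, B.Adj v a → B.Adj v b → a ≠ b → B.Adj a b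

lemma exists_simplicial_nonadj {V : Type} [DecidableEq V] (B : SimpleGraph V) (hch : Chordal B)
    (S : Finset V) : ∀ x ∈ S, ∀ y ∈ S, x ≠ y → ¬ B.Adj x y →
      ∃ v, SimplicialIn B S v ∧ v ≠ x ∧ ¬ B.Adj x v := by
  classical
  induction S using Finset.strongInduction with
  | H S ih =>
  intro x hx y hy hxy hnxy
  let r : V → V → Prop := fun u v => B.Adj u v ∧
    (u ∈ S ∧ u ≠ x ∧ ¬ B.Adj x u) ∧ (v ∈ S ∧ v ≠ x ∧ ¬ B.Adj x v)
  have rsymm : ∀ u v, r u v → r v u := fun u v h => ⟨h.1.symm, h.2.2, h.2.1⟩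
  let C : V → Prop := fun c => Relation.ReflTransGen r y c
  have hCS : ∀ c, C c → c ∈ S ∧ c ≠ x ∧ ¬ B.Adj x c := by
    intro c hc
    induction hc with
    | refl => exact ⟨hy, hxy.symm, hnxy⟩
    | tail _ h _ => exact h.2.2
  let N : V → Prop := fun a => a ∈ S ∧ ¬ C a ∧ ∃ c, C c ∧ B.Adj a c
  have hNx : ∀ a, N a → B.Adj x a := by
    rintro a ⟨haS, haC, c, hc, hac⟩
    have hc' := hCS c hc
    by_contra hxa
    apply haC
    refine Relation.ReflTransGen.tail hc ⟨hac.symm, hc', haS, ?_, hxa⟩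
    rintro rfl
    exact hc'.2.2 hac
  have hNclique : ∀ a b, N a → N b → a ≠ b → B.Adj a b := by
    intro a b ha hb hab
    obtain ⟨_, _, c, hc, hac⟩ := id ha
    obtain ⟨_, _, c', hc', hbc⟩ := id hb
    apply adj_of_walkThru B hch C a b x hab (hNx a ha) (hNx b hb) (fun c hc => (hCS c hc).2)
    refine exists_walkThru B C r (fun u v h => h.1) a c b c' hac hbc ?_ ?_
    · intro d hd; exact Relation.ReflTransGen.trans hc hd
    · have : Relation.ReflTransGen r c y := by
        have hs : Std.Symm r := ⟨rsymm⟩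
        exact Relation.ReflTransGen.stdSymm.symm _ _ hc
      exact this.trans hc'
  let T : Finset V := S.filter (fun v => C v ∨ N v)
  have hTmem : ∀ v, v ∈ T ↔ C v ∨ N v := by
    intro v
    simp only [T, Finset.mem_filter]
    constructor
    · exact fun h => h.2
    · rintro (h | h)
      · exact ⟨(hCS v h).1, Or.inl h⟩
      · exact ⟨h.1, Or.inr h⟩
  have hTS : T ⊂ S := by
    refine Finset.ssubset_iff_subset_ne.2 ⟨Finset.filter_subset _ _, ?_⟩
    intro he
    have : x ∈ T := he ▸ hx
    rcases (hTmem x).1 this with h | h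
    · exact (hCS x h).2.1 rfl
    · exact (hNx x h).ne rfl
  -- suffices simplicial in T lying in C
  suffices h : ∃ v, C v ∧ SimplicialIn B T v by
    obtain ⟨v, hv, hsimp⟩ := h
    have hv' := hCS v hv
    refine ⟨v, ⟨hv'.1, ?_⟩, hv'.2⟩
    have hnb : ∀ a ∈ S, B.Adj v a → a ∈ T := by
      intro a ha hva
      rw [hTmem]
      by_cases hCa : C a
      · exact Or.inl hCa
      · exact Or.inr ⟨ha, hCa, v, hv, hva.symm⟩
    intro a ha b hb hva hvb hab
    exact hsimp.2 a (hnb a ha hva) b (hnb b hb hvb) hva hvb hab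
  by_cases h1 : ∃ y' z, N y' ∧ z ∈ T ∧ y' ≠ z ∧ ¬ B.Adj y' z
  · obtain ⟨y', z, hy', hz, hne, hna⟩ := h1
    obtain ⟨v, hv, hvy, hnv⟩ := ih T hTS y' ((hTmem _).2 (Or.inr hy')) z hz hne hna
    refine ⟨v, ?_, hv⟩
    rcases (hTmem v).1 hv.1 with h | h
    · exact h
    · exact absurd (hNclique y' v hy' h hvy.symm) hnv
  · push Not at h1
    by_cases h2 : ∃ y' ∈ T, ∃ z ∈ T, y' ≠ z ∧ ¬ B.Adj y' z
    · obtain ⟨y', hy', z, hz, hne, hna⟩ := h2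
      obtain ⟨v, hv, hvy, hnv⟩ := ih T hTS y' hy' z hz hne hna
      refine ⟨v, ?_, hv⟩
      rcases (hTmem v).1 hv.1 with h | h
      · exact h
      · exact absurd (h1 v y' h hy' hvy).symm hnv
    · push Not at h2
      refine ⟨y, .refl, (hTmem y).2 (Or.inl .refl), ?_⟩
      intro a ha b hb _ _ hab
      exact h2 a ha b hb hab

lemma exists_simplicial {V : Type} [DecidableEq V] (B : SimpleGraph V) (hch : Chordal B)
    (S : Finset V) (hS : S.Nonempty) : ∃ v, SimplicialIn B S v := by
  by_cases h : ∃ x ∈ S, ∃ y ∈ S, x ≠ y ∧ ¬ B.Adj x y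
  · obtain ⟨x, hx, y, hy, hne, hna⟩ := h
    obtain ⟨v, hv, _⟩ := exists_simplicial_nonadj B hch S x hx y hy hne hna
    exact ⟨v, hv⟩
  · push Not at h
    obtain ⟨v, hv⟩ := hS
    exact ⟨v, hv, fun a ha b hb _ _ hab => h a ha b hb hab⟩

lemma psd_cauchy {V : Type} [Fintype V] [DecidableEq V] (M : Matrix V V ℝ) (hM : M.PosSemidef)
    (x y : V → ℝ) : (y ⬝ᵥ M *ᵥ x) ^ 2 ≤ (y ⬝ᵥ M *ᵥ y) * (x ⬝ᵥ M *ᵥ x) := by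
  have hsymm : Mᵀ = M := by
    have := hM.1
    rwa [IsHermitian, conjTranspose_eq_transpose_of_trivial] at this
  have hxy : x ⬝ᵥ M *ᵥ y = y ⬝ᵥ M *ᵥ x := by
    rw [dotProduct_mulVec, ← mulVec_transpose, hsymm, dotProduct_comm]
  have h : ∀ t : ℝ, 0 ≤ (y ⬝ᵥ M *ᵥ y) * (t * t) + (2 * (y ⬝ᵥ M *ᵥ x)) * t + x ⬝ᵥ M *ᵥ x := by
    intro t
    have h1 := hM.dotProduct_mulVec_nonneg (t • y + x)
    simp only [star_trivial, mulVec_add, mulVec_smul, dotProduct_add, add_dotProduct,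
      smul_dotProduct, dotProduct_smul, smul_eq_mul, hxy] at h1
    linarith
  have h2 := discrim_le_zero h
  rw [discrim] at h2
  linarith

lemma psd_sub_eps {V : Type} [Fintype V] [DecidableEq V] (M : Matrix V V ℝ) (hM : M.PosDef) :
    ∃ ε : ℝ, 0 < ε ∧ (M - ε • (1 : Matrix V V ℝ)).PosSemidef := by
  have hdet : IsUnit M.det := hM.isUnit.map Matrix.detMonoidHom
  let t : ℝ := ∑ v, (M⁻¹ v v)
  have ht : 0 ≤ t := Finset.sum_nonneg fun v _ => hM.inv.posSemidef.diag_nonneg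
  have key : ∀ x : V → ℝ, x ⬝ᵥ x ≤ t * (x ⬝ᵥ M *ᵥ x) := by
    intro x
    have hsymm : Mᵀ = M := by
      have := hM.1
      rwa [IsHermitian, conjTranspose_eq_transpose_of_trivial] at this
    have h1 : ∀ v, x v ^ 2 ≤ M⁻¹ v v * (x ⬝ᵥ M *ᵥ x) := by
      intro v
      have := psd_cauchy M hM.posSemidef x (M⁻¹ *ᵥ Pi.single v 1)
      have e1 : ∀ z : V → ℝ, (M⁻¹ *ᵥ Pi.single v 1) ⬝ᵥ M *ᵥ z = z v := by
        intro z
        rw [dotProduct_mulVec, ← mulVec_transpose, hsymm, mulVec_mulVec,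
          Matrix.mul_nonsing_inv _ hdet, one_mulVec]
        simp
      rw [e1, e1] at this
      simpa using this
    calc x ⬝ᵥ x = ∑ v, x v ^ 2 := by simp [dotProduct, sq]
      _ ≤ ∑ v, M⁻¹ v v * (x ⬝ᵥ M *ᵥ x) := Finset.sum_le_sum fun v _ => h1 v
      _ = t * (x ⬝ᵥ M *ᵥ x) := by rw [Finset.sum_mul]
  refine ⟨1 / (t + 1), by positivity, ?_⟩
  refine PosSemidef.of_dotProduct_mulVec_nonneg ?_ ?_
  · refine IsHermitian.sub hM.1 ?_
    rw [IsHermitian, conjTranspose_eq_transpose_of_trivial, transpose_smul, transpose_one]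
  · intro x
    have h0 : 0 ≤ x ⬝ᵥ M *ᵥ x := by simpa using hM.posSemidef.dotProduct_mulVec_nonneg x
    have h1 := key x
    rw [star_trivial, sub_mulVec, dotProduct_sub, smul_mulVec, one_mulVec, dotProduct_smul,
      smul_eq_mul, sub_nonneg, div_mul_eq_mul_div, div_le_iff₀ (by positivity)]
    linarith

lemma psd_step {V : Type} [Fintype V] [DecidableEq V] (M : Matrix V V ℝ) (hM : M.PosSemidef)
    (v : V) : (M - (1 / M v v) • vecMulVec (M v) (M v)).PosSemidef := by
  have hd : 0 ≤ M v v := hM.diag_nonneg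
  refine PosSemidef.of_dotProduct_mulVec_nonneg ?_ ?_
  · refine IsHermitian.sub hM.1 ?_
    rw [IsHermitian, conjTranspose_eq_transpose_of_trivial, transpose_smul, transpose_vecMulVec]
  · intro x
    have h0 : 0 ≤ x ⬝ᵥ M *ᵥ x := by simpa using hM.dotProduct_mulVec_nonneg x
    have h1 := psd_cauchy M hM x (Pi.single v 1)
    have e1 : ∀ z : V → ℝ, Pi.single v 1 ⬝ᵥ M *ᵥ z = M v ⬝ᵥ z := by
      intro z; simp [mulVec]
    rw [e1, e1] at h1
    have e2 : M v ⬝ᵥ Pi.single v 1 = M v v := by simp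
    rw [e2] at h1
    have e3 : x ⬝ᵥ vecMulVec (M v) (M v) *ᵥ x = (M v ⬝ᵥ x) ^ 2 := by
      rw [vecMulVec_mulVec]
      simp [dotProduct_comm, sq]
    rw [star_trivial, sub_mulVec, dotProduct_sub, smul_mulVec, dotProduct_smul,
      smul_eq_mul, sub_nonneg, e3]
    rcases hd.eq_or_lt with h | h
    · rw [← h]; simpa using h0
    · rw [one_div_mul_eq_div, div_le_iff₀ h]; linarith

lemma psd_zero_row {V : Type} [Fintype V] [DecidableEq V] (M : Matrix V V ℝ) (hM : M.PosSemidef)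
    (v : V) (h : M v v = 0) (u : V) : M v u = 0 := by
  have h1 := psd_cauchy M hM (Pi.single u 1) (Pi.single v 1)
  have e1 : ∀ a b, (Pi.single a 1 : V → ℝ) ⬝ᵥ M *ᵥ (Pi.single b 1) = M a b := by
    intro a b; simp
  rw [e1, e1, e1, h, zero_mul] at h1
  nlinarith

/-- Cholesky factorisation without fill-in, along a perfect elimination ordering. -/
lemma exists_cliques {V : Type} [Fintype V] [DecidableEq V] (B : SimpleGraph V)
    (hch : Chordal B) (S : Finset V) :
    ∃ R : V → V → Prop, (∀ h a b, R h a → R h b → a ≠ b → B.Adj a b) ∧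
      (∀ h a, R h a → h ∈ S) ∧
      ∀ M : Matrix V V ℝ, M.PosSemidef → BSupported B M → (∀ u v, u ∉ S → M u v = 0) →
        ∃ Γ : Matrix V V ℝ, SupportedOn R Γ ∧ M = Γᵀ * Γ := by
  classical
  induction S using Finset.strongInduction with
  | H S ih =>
  rcases S.eq_empty_or_nonempty with rfl | hS
  · refine ⟨fun _ _ => False, by simp, by simp, ?_⟩
    intro M _ _ h0
    refine ⟨0, fun _ _ _ => rfl, ?_⟩
    ext u v
    simp [h0 u v]
  obtain ⟨v, hvS, hv⟩ := exists_simplicial B hch S hS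
  obtain ⟨R, hR1, hR2, hR3⟩ := ih (S.erase v) (Finset.erase_ssubset hvS)
  refine ⟨fun h a => if h = v then (a = v ∨ (a ∈ S ∧ B.Adj v a)) else R h a, ?_, ?_, ?_⟩
  · intro h a b ha hb hab
    by_cases hh : h = v
    · simp only [hh, if_true] at ha hb
      rcases ha with rfl | ⟨haS, ha⟩
      · rcases hb with rfl | ⟨hbS, hb⟩
        · exact absurd rfl hab
        · exact hb
      · rcases hb with rfl | ⟨hbS, hb⟩
        · exact ha.symm
        · exact hv a haS b hbS ha hb hab
    · simp only [hh, if_false] at ha hb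
      exact hR1 h a b ha hb hab
  · intro h a ha
    by_cases hh : h = v
    · exact hh ▸ hvS
    · simp only [hh, if_false] at ha
      exact Finset.mem_of_mem_erase (hR2 h a ha)
  · intro M hM hB h0
    have hsymm : ∀ a b, M a b = M b a := by
      intro a b
      have := hM.1.apply a b
      simpa using this.symm
    have hd : 0 ≤ M v v := hM.diag_nonneg
    have hrow : ∀ a, ¬ (a = v ∨ (a ∈ S ∧ B.Adj v a)) → M v a = 0 := by
      intro a ha
      push Not at ha
      by_cases haS : a ∈ S
      · exact hB v a (Ne.symm ha.1) (ha.2 haS)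
      · rw [hsymm]; exact h0 a v haS
    obtain ⟨Γ, hΓ, hMΓ⟩ := hR3 (M - (1 / M v v) • vecMulVec (M v) (M v)) (psd_step M hM v) (by
      intro a b hab hnab
      have h1 : M v a * M v b = 0 := by
        by_contra hne
        have ha : M v a ≠ 0 := left_ne_zero_of_mul hne
        have hb : M v b ≠ 0 := right_ne_zero_of_mul hne
        have ha' := not_imp_comm.1 (hrow a) ha
        have hb' := not_imp_comm.1 (hrow b) hb
        rcases ha' with rfl | ⟨haS, ha'⟩
        · rcases hb' with rfl | ⟨hbS, hb'⟩
          · exact hab rfl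
          · exact hnab hb'
        · rcases hb' with rfl | ⟨hbS, hb'⟩
          · exact hnab ha'.symm
          · exact hnab (hv a haS b hbS ha' hb' hab)
      simp [vecMulVec_apply, h1, hB a b hab hnab]) (by
      intro a b ha
      by_cases hav : a = v
      · subst hav
        by_cases hz : M a a = 0
        · simp [vecMulVec_apply, hz, psd_zero_row M hM a hz b]
        · simp [vecMulVec_apply]
          field_simp
          simp
      · have haS : a ∉ S := fun h => ha (Finset.mem_erase.2 ⟨hav, h⟩)
        simp [vecMulVec_apply, h0 a b haS, hsymm v a, h0 a v haS])
    have hΓv : ∀ a, Γ v a = 0 := fun a => hΓ v a fun h => by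
      have := hR2 v a h
      simp at this
    refine ⟨Matrix.of fun h a => if h = v then M v a / √(M v v) else Γ h a, ?_, ?_⟩
    · intro h a ha
      by_cases hh : h = v
      · simp only [hh, if_true, of_apply] at ha ⊢
        rw [hrow a ha, zero_div]
      · simp only [hh, if_false, of_apply] at ha ⊢
        exact hΓ h a ha
    · refine (add_eq_of_eq_sub hMΓ.symm).symm.trans ?_
      ext a b
      simp only [Matrix.add_apply, Matrix.mul_apply, transpose_apply, Matrix.smul_apply,
        vecMulVec_apply, smul_eq_mul]
      rw [← Finset.add_sum_erase _ _ (Finset.mem_univ v),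
        ← Finset.add_sum_erase _ _ (Finset.mem_univ v)]
      rw [hΓv, zero_mul, zero_add, add_comm]
      congr 1
      · simp only [if_true, of_apply]
        rw [div_mul_div_comm, Real.mul_self_sqrt hd]
        ring
      · refine Finset.sum_congr rfl fun h hh => ?_
        have : h ≠ v := (Finset.mem_erase.1 hh).1
        simp [this]

lemma isUnit_one_sub {V : Type} [Fintype V] [DecidableEq V] (D : V → V → Prop) (hD : Acyclic D)
    (L : Matrix V V ℝ) (hL : SupportedOn D L) : IsUnit (1 - L) := by
  rw [Matrix.isUnit_iff_isUnit_det, isUnit_iff_ne_zero]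
  intro hdet
  obtain ⟨x, hx0, hx⟩ := Matrix.exists_mulVec_eq_zero_iff.2 hdet
  apply hx0
  have hx' : ∀ u, x u = ∑ w, L u w * x w := by
    intro u
    have := congrFun hx u
    rw [sub_mulVec, one_mulVec] at this
    simpa [mulVec, dotProduct, sub_eq_zero] using this
  let r : V → V → Prop := fun a b => Relation.TransGen D b a
  have h1 : IsTrans V r := ⟨fun a b c hab hbc => hbc.trans hab⟩
  have h2 : Std.Irrefl r := ⟨fun a => hD a⟩
  have hwf : WellFounded r := Finite.wellFounded_of_trans_of_irrefl r
  funext u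
  induction u using hwf.induction with
  | h u ih =>
  rw [hx' u]
  refine Finset.sum_eq_zero fun w _ => ?_
  by_cases hD' : D u w
  · rw [ih w (.single hD')]; simp
  · rw [hL u w hD', zero_mul]

/-- The digraph on `V ⊕ V` with hidden vertices `inr h` pointing into the cliques `R h`. -/
def hidE {V : Type} (D R : V → V → Prop) : V ⊕ V → V ⊕ V → Prop
  | .inl u, .inl v => D u v
  | .inr h, .inl v => R h v
  | _, .inr _ => False

lemma hidE_acyclic {V : Type} (D R : V → V → Prop) (hD : Acyclic D) : Acyclic (hidE D R) := by
  have h1 : ∀ a b, Relation.TransGen (hidE D R) a b → ∃ v, b = .inl v := by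
    intro a b h
    induction h with
    | @single b h => rcases b with v | v
                     · exact ⟨v, rfl⟩
                     · rcases a with a | a <;> exact h.elim
    | @tail c b _ h => rcases b with v | v
                       · exact ⟨v, rfl⟩
                       · rcases c with a | a <;> exact h.elim
  have h2 : ∀ u b, Relation.TransGen (hidE D R) (.inl u) b →
      ∀ v, b = .inl v → Relation.TransGen D u v := by
    intro u b h
    induction h with
    | single h => rintro v rfl; exact .single h
    | @tail c b hc h ih =>
      rintro v rfl
      obtain ⟨w, rfl⟩ := h1 _ _ hc
      exact (ih w rfl).tail h
  intro a ha
  obtain ⟨v, rfl⟩ := h1 _ _ ha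
  exact hD v (h2 v _ ha v rfl)

lemma block_cov {V : Type} [Fintype V] [DecidableEq V] (L Γ W W' : Matrix V V ℝ)
    (hL : IsUnit (1 - L)) :
    ((((1 - (fromBlocks L 0 Γ 0 : Matrix (V ⊕ V) (V ⊕ V) ℝ))⁻¹)ᵀ * fromBlocks W 0 0 W' *
      (1 - (fromBlocks L 0 Γ 0 : Matrix (V ⊕ V) (V ⊕ V) ℝ))⁻¹).submatrix (Sum.inl : V → V ⊕ V) Sum.inl) =
      ((1 - L)⁻¹)ᵀ * (W + Γᵀ * W' * Γ) * (1 - L)⁻¹ := by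
  have e : (1 - fromBlocks L 0 Γ 0 : Matrix (V ⊕ V) (V ⊕ V) ℝ) = fromBlocks (1 - L) 0 (-Γ) 1 := by
    rw [← fromBlocks_one, sub_eq_add_neg, fromBlocks_neg, fromBlocks_add]
    simp [sub_eq_add_neg]
  rw [e, inv_fromBlocks_zero₁₂_of_isUnit_iff _ _ _ (by simp [hL]), fromBlocks_transpose,
    fromBlocks_multiply, fromBlocks_multiply]
  change toBlocks₁₁ _ = _
  rw [toBlocks_fromBlocks₁₁]
  simp only [inv_one, one_mul, Matrix.mul_zero, add_zero, zero_add, neg_mul, mul_neg, neg_neg,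
    transpose_zero, Matrix.zero_mul, transpose_mul, Matrix.mul_add, Matrix.add_mul, Matrix.mul_assoc,
    Matrix.transpose_neg, Matrix.mul_one]

theorem stmt7 {V : Type} [Fintype V] [DecidableEq V] (D : V → V → Prop)
    (B : SimpleGraph V) (hD : Acyclic D) (hch : Chordal B) :
    StrictlyGaussianCausal D B := by
  obtain ⟨R, hR1, -, hR3⟩ := exists_cliques B hch Finset.univ
  refine ⟨V ⊕ V, inferInstance, inferInstance, Function.Embedding.inl, hidE D R,
    hidE_acyclic D R hD, ?_⟩
  ext S
  constructor
  · rintro ⟨_, ⟨Λ, Ω, hΛ, hΩ, hpos, rfl⟩, rfl⟩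
    have e1 : Λ = fromBlocks Λ.toBlocks₁₁ 0 Λ.toBlocks₂₁ 0 := by
      ext (u | u) (v | v)
      · rfl
      · exact hΛ _ _ (fun h => h)
      · rfl
      · exact hΛ _ _ (fun h => h)
    have e2 : Ω = fromBlocks (diagonal fun u => Ω (.inl u) (.inl u)) 0 0
        (diagonal fun u => Ω (.inr u) (.inr u)) := by
      ext (u | u) (v | v)
      · by_cases h : u = v
        · subst h; simp
        · simpa [h] using hΩ (i := Sum.inl u) (j := Sum.inl v) (by simpa using h)
      · exact hΩ (by simp)
      · exact hΩ (by simp)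
      · by_cases h : u = v
        · subst h; simp
        · simpa [h] using hΩ (i := Sum.inr u) (j := Sum.inr v) (by simpa using h)
    have hL : SupportedOn D Λ.toBlocks₁₁ := fun u v h => hΛ _ _ h
    have hG : SupportedOn R Λ.toBlocks₂₁ := fun u v h => hΛ _ _ h
    have hp1 : ∀ u, 0 < Ω (.inl u) (.inl u) := fun u => hpos _
    have hp2 : ∀ u, 0 ≤ Ω (.inr u) (.inr u) := fun u => (hpos _).le
    refine ⟨Λ.toBlocks₁₁, diagonal (fun u => Ω (.inl u) (.inl u)) +
      Λ.toBlocks₂₁ᵀ * diagonal (fun u => Ω (.inr u) (.inr u)) * Λ.toBlocks₂₁, hL, ?_, ?_, ?_⟩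
    · refine PosDef.add_posSemidef (PosDef.diagonal hp1) ?_
      rw [← conjTranspose_eq_transpose_of_trivial]
      exact (PosSemidef.diagonal hp2).conjTranspose_mul_mul_same _
    · intro u v huv hn
      rw [Matrix.add_apply, diagonal_apply_ne _ huv, zero_add, Matrix.mul_apply]
      refine Finset.sum_eq_zero fun h _ => ?_
      rw [mul_diagonal, transpose_apply]
      by_cases hu : R h u
      · have hv : ¬ R h v := fun hv => hn (hR1 h u v hu hv huv)
        rw [hG h v hv, mul_zero]
      · rw [hG h u hu, zero_mul, zero_mul]
    · rw [← block_cov _ _ _ _ (isUnit_one_sub D hD _ hL), ← e1, ← e2]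
      rfl
  · rintro ⟨Λ, Ω, hΛ, hΩ, hB, rfl⟩
    obtain ⟨ε, hε, hpsd⟩ := psd_sub_eps Ω hΩ
    obtain ⟨Γ, hΓ, hM⟩ := hR3 _ hpsd (by
      intro u v huv hn
      simp [hB u v huv hn, huv]) (by simp)
    refine ⟨_, ⟨fromBlocks Λ 0 Γ 0, fromBlocks (ε • 1) 0 0 1, ?_, ?_, ?_, rfl⟩, ?_⟩
    · rintro (u | u) (v | v) h
      · exact hΛ u v h
      · rfl
      · exact hΓ u v h
      · rfl
    · rintro (u | u) (v | v) h
      · have : u ≠ v := by simpa using h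
        simp [this]
      · rfl
      · rfl
      · have : u ≠ v := by simpa using h
        simp [this]
    · rintro (u | u) <;> simp [hε]
    · refine (block_cov Λ Γ _ _ (isUnit_one_sub D hD Λ hΛ)).trans ?_
      rw [Matrix.mul_one, ← hM]
      simp
end

section
/- Sign-change invariance of determinants: Let Σ = (I−Γ)^{-T} Δ (I−Γ)^{-1} and Σ' = (I−Γ')^{-T} Δ (I−Γ')^{-1} where Γ' is obtained from Γ by negating precisely the entries corresponding to edges in E_A(1,2). Then, under the hypotheses of the chain graph setting: (i) det(Σ'_{A,A}) = det(Σ_{A,A}); (ii) det(Σ'_{{1}∪A, {2}∪A}) = −det(Σ_{{1}∪A, {2}∪A}); (iii) det(Σ'_{{u}∪A, {v}∪A}) = det(Σ_{{u}∪A, {v}∪A}) for all (u,v) ∈ ([p]×[p]) ∖ {(1,2),(2,1)}. -/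
open Matrix BigOperators

def subMatrixA {U : Type} (A : Finset U) (S : Matrix U U ℝ) :
    Matrix {x // x ∈ A} {x // x ∈ A} ℝ :=
  Matrix.of fun a b => S a.1 b.1

def augMatrix {U : Type} (A : Finset U) (S : Matrix U U ℝ) (u v : U) :
    Matrix (Unit ⊕ {x // x ∈ A}) (Unit ⊕ {x // x ∈ A}) ℝ :=
  Matrix.of fun i j =>
    S (Sum.elim (fun _ => u) Subtype.val i) (Sum.elim (fun _ => v) Subtype.val j)

namespace P15

/-- Directed reachability inside the complement of `A`. -/
abbrev Rch {U : Type} (E : U → U → Prop) (A : Set U) : U → U → Prop :=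
  Relation.ReflTransGen (fun a b => E a b ∧ a ∉ A ∧ b ∉ A)

/-- `s` has a directed path to `a ∈ A`, otherwise avoiding `A`. -/
def ToA {U : Type} (E : U → U → Prop) (A : Set U) (s a : U) : Prop :=
  ∃ x, Rch E A s x ∧ E x a ∧ x ∉ A ∧ a ∈ A

def Sim {U : Type} (E : U → U → Prop) (A : Set U) (s t : U) : Prop :=
  ∃ a, ToA E A s a ∧ ToA E A t a

def LL {U : Type} (E : U → U → Prop) (A : Set U) (v s : U) : Prop :=
  ∃ t, Relation.ReflTransGen (Sim E A) s t ∧ Rch E A t v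

/-- Inductive version of d-connecting walks to `v`: first direction, start, top. -/
inductive W {U : Type} (E : U → U → Prop) (A : Set U) (v : U) : Bool → U → U → Prop
  | lastF (x : U) : E x v → W E A v true x x
  | lastB (x : U) : E v x → W E A v false x v
  | ff (x y t : U) : E x y → W E A v true y t → y ∉ A → W E A v true x x
  | fb (x y t : U) : E x y → W E A v false y t → y ∈ A → W E A v true x x
  | bf (x y t : U) : E y x → W E A v true y t → y ∉ A → W E A v false x t
  | bb (x y t : U) : E y x → W E A v false y t → y ∉ A → W E A v false x t

section comb
variable {U : Type} {E : U → U → Prop} {A : Set U}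

theorem Sim.symm {s t : U} (h : Sim E A s t) : Sim E A t s := by
  obtain ⟨a, h1, h2⟩ := h
  exact ⟨a, h2, h1⟩

theorem ToA.of_rch {s t a : U} (h : Rch E A s t) (h' : ToA E A t a) : ToA E A s a := by
  obtain ⟨x, h1, h2⟩ := h'
  exact ⟨x, h.trans h1, h2⟩

theorem LL.of_sim {v s t : U} (h : Sim E A s t) (h' : LL E A v t) : LL E A v s := by
  obtain ⟨x, h1, h2⟩ := h'
  exact ⟨x, h1.head h, h2⟩

theorem LL.of_conn {v s t : U} (h : Relation.ReflTransGen (Sim E A) s t) (h' : LL E A v s) :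
    LL E A v t := by
  induction h with
  | refl => exact h'
  | tail _ h2 ih => exact LL.of_sim h2.symm ih

theorem LL.of_rch {v s t : U} (h : Rch E A s t) (h' : LL E A v t) : LL E A v s := by
  obtain ⟨x, h1, h2⟩ := h'
  rcases Relation.ReflTransGen.cases_head h1 with rfl | ⟨y, ⟨a, h3, h4⟩, h5⟩
  · exact ⟨s, .refl, h.trans h2⟩
  · exact ⟨x, h5.head ⟨a, h3.of_rch h, h4⟩, h2⟩

theorem W.topT {v x t : U} {d : Bool} (h : W E A v d x t) : d = true → t = x := by
  cases h <;> simp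

theorem W.fwd {v x t : U} {d : Bool} (hv : v ∉ A) (h : W E A v d x t) :
    (d = true → x ∉ A → LL E A v x) ∧
    (d = false → t ∉ A ∧ ∃ y, E y x ∧ y ∉ A ∧ Rch E A t y ∧ LL E A v t) := by
  induction h with
  | lastF x h => exact ⟨fun _ hx => ⟨x, .refl, .single ⟨h, hx, hv⟩⟩, by simp⟩
  | lastB x h => exact ⟨by simp, fun _ => ⟨hv, v, h, hv, .refl, ⟨v, .refl, .refl⟩⟩⟩
  | ff x y t h _ hy ih =>
    exact ⟨fun _ hx => LL.of_rch (.single ⟨h, hx, hy⟩) (ih.1 rfl hy), by simp⟩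
  | fb x y t h _ hy ih =>
    refine ⟨fun _ hx => ?_, by simp⟩
    obtain ⟨_, z, h1, h2, h3, h4⟩ := ih.2 rfl
    exact LL.of_sim ⟨y, ⟨x, .refl, h, hx, hy⟩, ⟨z, h3, h1, h2, hy⟩⟩ h4
  | bf x y t h h' hy ih =>
    refine ⟨by simp, fun _ => ?_⟩
    obtain rfl := h'.topT rfl
    exact ⟨hy, t, h, hy, .refl, ih.1 rfl hy⟩
  | bb x y t h h' hy ih =>
    refine ⟨by simp, fun _ => ?_⟩
    obtain ⟨h0, z, h1, h2, h3, h4⟩ := ih.2 rfl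
    exact ⟨h0, y, h, hy, h3.tail ⟨h1, h2, hy⟩, h4⟩

theorem W.ext_fwd {v x y : U} (h : Rch E A x y) (h' : W E A v true y y) : W E A v true x x := by
  induction h using Relation.ReflTransGen.head_induction_on with
  | refl => exact h'
  | head h1 _ ih => exact .ff _ _ _ h1.1 ih h1.2.2

theorem W.ext_bwd {v s x z : U} (h : Rch E A s x) (hE : E x z) (hx : x ∉ A)
    (h' : s = v ∨ W E A v true s s) : W E A v false z s := by
  induction h generalizing z with
  | refl =>
    rcases h' with rfl | h'
    · exact .lastB _ hE
    · exact .bf _ _ _ hE h' hx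
  | tail _ h2 ih => exact .bb _ _ _ hE (ih h2.1 h2.2.1) hx

theorem W.of_LL {v s : U} (h : LL E A v s) : s = v ∨ W E A v true s s := by
  obtain ⟨t, h1, h2⟩ := h
  induction h1 using Relation.ReflTransGen.head_induction_on with
  | refl =>
    rcases Relation.ReflTransGen.cases_tail h2 with h | ⟨y, h3, h4⟩
    · exact .inl h.symm
    · exact .inr (W.ext_fwd h3 (.lastF _ h4.1))
  | head h3 _ ih =>
    obtain ⟨a, ⟨x, hx1, hx2, hx3, hx4⟩, ⟨y, hy1, hy2, hy3, hy4⟩⟩ := h3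
    exact .inr (W.ext_fwd hx1 (.fb _ _ _ hx2 (W.ext_bwd hy1 hy2 hy3 ih) hx4))

theorem W.of_rch_LL {u v s : U} (huv : u ≠ v) (h1 : Rch E A s u) (h : LL E A v s) :
    ∃ d, W E A v d u s := by
  rcases Relation.ReflTransGen.cases_tail h1 with rfl | ⟨y, h3, h4⟩
  · rcases W.of_LL h with h | h
    · exact absurd h huv
    · exact ⟨_, h⟩
  · exact ⟨_, W.ext_bwd h3 h4.1 h4.2.1 (W.of_LL h)⟩

theorem W.of_list {v : U} (l : List (Bool × U × U)) (ne : l ≠ [])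
    (last_eq : (l.getLast ne).2.2 = v)
    (edge : ∀ s ∈ l, (s.1 = true → E s.2.1 s.2.2) ∧ (s.1 = false → E s.2.2 s.2.1))
    (chain : List.IsChain (fun s t : Bool × U × U => s.2.2 = t.2.1) l)
    (ok : List.IsChain (stepPairOK A) l) (w : U) :
    W E A v (l.head ne).1 (l.head ne).2.1 (topOf l w) := by
  induction l generalizing w with
  | nil => exact absurd rfl ne
  | cons s l ih =>
    obtain ⟨d, a, b⟩ := s
    cases l with
    | nil =>
      simp at last_eq edge
      subst last_eq
      cases d <;> simp [topOf] at edge ⊢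
      · exact .lastB _ edge
      · exact .lastF _ edge
    | cons s' l =>
      obtain ⟨d', a', b'⟩ := s'
      rw [List.isChain_cons_cons] at chain ok
      have ih' := ih (by simp) (by simpa using last_eq)
        (fun s hs => edge s (List.mem_cons_of_mem _ hs)) chain.2 ok.2 b
      have e1 := edge (d, a, b) (by simp)
      have c1 := chain.1
      have o1 := ok.1
      simp only [stepPairOK] at e1 c1 o1
      subst c1
      simp only [List.head_cons] at ih' ⊢
      cases d <;> cases d' <;> simp at e1 o1
      · simpa [topOf] using W.bb _ _ _ e1 ih' o1
      · simpa [topOf] using W.bf _ _ _ e1 ih' o1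
      · simpa [topOf] using W.fb _ _ _ e1 ih' o1
      · simpa [topOf] using W.ff _ _ _ e1 ih' o1

theorem W.cons_list {v x y t : U} {d' : Bool} (d : Bool)
    (hE : (d = true → E x y) ∧ (d = false → E y x))
    (hok : ((d = true ∧ d' = false) → y ∈ A) ∧ (¬(d = true ∧ d' = false) → y ∉ A))
    (h : ∃ (l : List (Bool × U × U)) (b : U),
      (((d', y, b) :: l).getLast (by simp)).2.2 = v ∧
      (∀ s ∈ (d', y, b) :: l, (s.1 = true → E s.2.1 s.2.2) ∧ (s.1 = false → E s.2.2 s.2.1)) ∧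
      List.IsChain (fun s t : Bool × U × U => s.2.2 = t.2.1) ((d', y, b) :: l) ∧
      List.IsChain (stepPairOK A) ((d', y, b) :: l) ∧ ∀ w, topOf ((d', y, b) :: l) w = t) :
    ∃ (l : List (Bool × U × U)) (b : U),
      (((d, x, b) :: l).getLast (by simp)).2.2 = v ∧
      (∀ s ∈ (d, x, b) :: l, (s.1 = true → E s.2.1 s.2.2) ∧ (s.1 = false → E s.2.2 s.2.1)) ∧
      List.IsChain (fun s t : Bool × U × U => s.2.2 = t.2.1) ((d, x, b) :: l) ∧
      List.IsChain (stepPairOK A) ((d, x, b) :: l) ∧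
      ∀ w, topOf ((d, x, b) :: l) w = if d then x else t := by
  obtain ⟨l, b, h1, h2, h3, h4, h5⟩ := h
  refine ⟨(d', y, b) :: l, y, by simpa using h1, ?_, ?_, ?_, ?_⟩
  · intro s hs
    rcases List.mem_cons.1 hs with rfl | hs
    · exact hE
    · exact h2 s hs
  · exact List.isChain_cons_cons.2 ⟨rfl, h3⟩
  · exact List.isChain_cons_cons.2 ⟨hok, h4⟩
  · intro w
    rw [topOf, h5]

theorem W.to_list {v x t : U} {d : Bool} (h : W E A v d x t) :
    ∃ (l : List (Bool × U × U)) (b : U),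
      (((d, x, b) :: l).getLast (by simp)).2.2 = v ∧
      (∀ s ∈ (d, x, b) :: l, (s.1 = true → E s.2.1 s.2.2) ∧ (s.1 = false → E s.2.2 s.2.1)) ∧
      List.IsChain (fun s t : Bool × U × U => s.2.2 = t.2.1) ((d, x, b) :: l) ∧
      List.IsChain (stepPairOK A) ((d, x, b) :: l) ∧
      ∀ w, topOf ((d, x, b) :: l) w = t := by
  induction h with
  | lastF x h => exact ⟨[], v, by simp, by simpa using h, by simp, by simp, by simp [topOf]⟩
  | lastB x h => exact ⟨[], v, by simp, by simpa using h, by simp, by simp, by simp [topOf]⟩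
  | ff x y t h _ hy ih => simpa using W.cons_list true (by simpa using h) (by simpa using hy) ih
  | fb x y t h _ hy ih => simpa using W.cons_list true (by simpa using h) (by simpa using hy) ih
  | bf x y t h _ hy ih => simpa using W.cons_list false (by simpa using h) (by simpa using hy) ih
  | bb x y t h _ hy ih => simpa using W.cons_list false (by simpa using h) (by simpa using hy) ih

theorem tops_iff {u v t : U} (hu : u ∉ A) (hv : v ∉ A) (huv : u ≠ v) :
    t ∈ TopsA E A u v ↔ Rch E A t u ∧ LL E A v t := by
  constructor
  · rintro ⟨w, h1, h2⟩
    have h := W.of_list (E := E) (A := A) w.steps w.ne w.last_eq w.edge w.chain h1 u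
    rw [w.first_eq] at h
    change W E A v _ u w.top at h
    rw [h2] at h
    have hf := h.fwd hv
    cases hd : (w.steps.head w.ne).1
    · obtain ⟨_, y, h1, h2, h3, h4⟩ := hf.2 hd
      exact ⟨h3.tail ⟨h1, h2, hu⟩, h4⟩
    · obtain rfl := h.topT hd
      exact ⟨.refl, hf.1 hd hu⟩
  · rintro ⟨h1, h2⟩
    obtain ⟨d, h⟩ := W.of_rch_LL huv h1 h2
    obtain ⟨l, b, h1, h2, h3, h4, h5⟩ := h.to_list
    exact ⟨⟨(d, u, b) :: l, by simp, rfl, h1, h2, h3⟩, h4, h5 u⟩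

theorem conn_of {u v s : U} (hu : u ∉ A) (hv : v ∉ A) (huv : u ≠ v)
    (h1 : Rch E A s u) (h2 : LL E A v s) : ∃ w : DWalk E u v, w.DConn A := by
  obtain ⟨w, h, _⟩ := (tops_iff hu hv huv).2 ⟨h1, h2⟩
  exact ⟨w, h⟩

theorem of_conn {u v : U} (hu : u ∉ A) (hv : v ∉ A) (huv : u ≠ v)
    (h : ∃ w : DWalk E u v, w.DConn A) : ∃ s, Rch E A s u ∧ LL E A v s := by
  obtain ⟨w, h⟩ := h
  exact ⟨w.top, (tops_iff hu hv huv).1 ⟨w, h, rfl⟩⟩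

end comb
section la
open Matrix

theorem det_one_sub {n : Type} [Fintype n] [DecidableEq n] (b : n → ℕ) (G : Matrix n n ℝ)
    (h : ∀ i j, G i j ≠ 0 → b j < b i) : (1 - G).det = 1 := by
  rw [← Matrix.det_transpose]
  have hbt : ((1 - G)ᵀ).BlockTriangular b := by
    intro i j hij
    have h0 : G j i = 0 := by
      by_contra h0
      exact absurd (h j i h0) (by omega)
    have hne : j ≠ i := by rintro rfl; omega
    simp [hne, h0]
  rw [hbt.det]
  apply Finset.prod_eq_one
  intro k _
  have : ((1 - G)ᵀ).toSquareBlock b k = 1 := by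
    ext ⟨i, hi⟩ ⟨j, hj⟩
    have h0 : G j i = 0 := by
      by_contra h0
      exact absurd (h j i h0) (by omega)
    simp [Matrix.toSquareBlock_def, Matrix.one_apply, h0]
  rw [this, Matrix.det_one]

theorem supp_lemma {n : Type} [Fintype n] [DecidableEq n] (b : n → ℕ) (G : Matrix n n ℝ)
    (h : ∀ i j, G i j ≠ 0 → b j < b i) (f g : n → ℝ) (hf : (1 - G) *ᵥ f = g)
    (P : n → Prop) (hg : ∀ i, g i ≠ 0 → P i) (hG : ∀ i j, G i j ≠ 0 → P j → P i) :
    ∀ i, f i ≠ 0 → P i := by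
  have key : ∀ k i, b i = k → f i ≠ 0 → P i := by
    intro k
    induction k using Nat.strong_induction_on with
    | _ k ih =>
      intro i hi hfi
      by_contra hP
      have e := congrFun hf i
      have hg0 : g i = 0 := by
        by_contra h0
        exact hP (hg i h0)
      rw [Matrix.sub_mulVec, Matrix.one_mulVec, Pi.sub_apply, hg0] at e
      have hs : (G *ᵥ f) i = 0 := by
        apply Finset.sum_eq_zero
        intro j _
        by_contra h0
        have h1 := left_ne_zero_of_mul h0
        have h2 := right_ne_zero_of_mul h0
        exact hP (hG i j h1 (ih (b j) (hi ▸ h i j h1) j rfl h2))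
      rw [hs] at e
      exact hfi (by linarith)
  exact fun i => key _ i rfl

theorem schur {a b : Type} [Fintype a] [DecidableEq a] [Fintype b] [DecidableEq b]
    (S11 : Matrix a a ℝ) (S12 : Matrix a b ℝ) (S21 : Matrix b a ℝ) (S22 : Matrix b b ℝ)
    (K11 : Matrix a a ℝ) (K12 : Matrix a b ℝ) (K21 : Matrix b a ℝ) (K22 : Matrix b b ℝ)
    (h : fromBlocks S11 S12 S21 S22 * fromBlocks K11 K12 K21 K22 = 1)
    (hS : IsUnit S11.det) :
    (S22 - S21 * S11⁻¹ * S12) * K22 = 1 ∧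
    S11.det = (fromBlocks S11 S12 S21 S22).det * K22.det := by
  have h' := h
  rw [fromBlocks_multiply, ← fromBlocks_one, fromBlocks_inj] at h
  obtain ⟨-, h2, -, h4⟩ := h
  have e : K12 = - (S11⁻¹ * S12 * K22) := by
    have := congrArg (fun X => S11⁻¹ * X) h2
    simp only [Matrix.mul_add, ← Matrix.mul_assoc, Matrix.nonsing_inv_mul _ hS, Matrix.one_mul,
      Matrix.mul_zero] at this
    exact eq_neg_of_add_eq_zero_left this
  have k : (S22 - S21 * S11⁻¹ * S12) * K22 = 1 := by
    rw [← h4, e, Matrix.sub_mul, Matrix.mul_neg]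
    simp only [Matrix.mul_assoc]
    abel
  refine ⟨k, ?_⟩
  have := S11.invertibleOfIsUnitDet hS
  rw [det_fromBlocks₁₁, invOf_eq_nonsing_inv, mul_assoc, ← det_mul, k, det_one, mul_one]

variable {U : Type} [Fintype U] [DecidableEq U]

abbrev bAA (A : Finset U) (S : Matrix U U ℝ) : Matrix {x // x ∈ A} {x // x ∈ A} ℝ :=
  S.submatrix Subtype.val Subtype.val
abbrev bAB (A : Finset U) (S : Matrix U U ℝ) : Matrix {x // x ∈ A} {x // ¬ x ∈ A} ℝ :=
  S.submatrix Subtype.val Subtype.val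
abbrev bBA (A : Finset U) (S : Matrix U U ℝ) : Matrix {x // ¬ x ∈ A} {x // x ∈ A} ℝ :=
  S.submatrix Subtype.val Subtype.val
abbrev bBB (A : Finset U) (S : Matrix U U ℝ) : Matrix {x // ¬ x ∈ A} {x // ¬ x ∈ A} ℝ :=
  S.submatrix Subtype.val Subtype.val

theorem blocks_eq (A : Finset U) (S : Matrix U U ℝ) :
    fromBlocks (bAA A S) (bAB A S) (bBA A S) (bBB A S) =
      S.submatrix (Equiv.sumCompl (· ∈ A)) (Equiv.sumCompl (· ∈ A)) := by
  ext (i | i) (j | j) <;> simp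

theorem one_block (A : Finset U) (G : Matrix U U ℝ) : bBB A (1 - G) = 1 - bBB A G := by
  ext i j
  simp [Matrix.one_apply, Subtype.ext_iff]

theorem main_la (A : Finset U) (G : Matrix U U ℝ) (d : U → ℝ) (hd : ∀ u, 0 < d u)
    (hdet : (1 - G).det = 1) (hdetB : (1 - bBB A G).det = 1)
    (Q : Matrix {x // ¬ x ∈ A} {x // x ∈ A} ℝ) (hQ : (1 - bBB A G) * Q = bBA A G)
    (X : Matrix {x // ¬ x ∈ A} {x // ¬ x ∈ A} ℝ)
    (hX : X = diagonal (fun i : {x // ¬ x ∈ A} => (d i)⁻¹) +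
      Q * diagonal (fun i : {x // x ∈ A} => (d i)⁻¹) * Qᵀ) :
    (subMatrixA A (((1 - G)⁻¹)ᵀ * diagonal d * (1 - G)⁻¹)).det = (diagonal d).det * X.det ∧
    ∀ (u v : {x // ¬ x ∈ A}) (pu pv : {x // ¬ x ∈ A} → ℝ),
      (1 - bBB A G) *ᵥ pu = Pi.single u 1 → (1 - bBB A G) *ᵥ pv = Pi.single v 1 →
      (augMatrix A (((1 - G)⁻¹)ᵀ * diagonal d * (1 - G)⁻¹) u v).det =
        (diagonal d).det * X.det * (pu ⬝ᵥ (X⁻¹ *ᵥ pv)) := by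
  set M := 1 - G with hM
  set S := (M⁻¹)ᵀ * diagonal d * M⁻¹ with hSdef
  set K := M * diagonal (fun i => (d i)⁻¹) * Mᵀ with hK
  have hMu : IsUnit M.det := by rw [hdet]; exact isUnit_one
  have hdd : diagonal d * diagonal (fun i => (d i)⁻¹) = 1 := by
    rw [diagonal_mul_diagonal, ← diagonal_one]
    congr 1; ext i; exact mul_inv_cancel₀ (hd i).ne'
  have hSK : S * K = 1 := by
    calc S * K = (M⁻¹)ᵀ * (diagonal d * ((M⁻¹ * M) * diagonal (fun i => (d i)⁻¹))) * Mᵀ := by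
          simp only [hSdef, hK, Matrix.mul_assoc]
      _ = 1 := by
          rw [nonsing_inv_mul _ hMu, Matrix.one_mul, hdd, Matrix.mul_one, ← transpose_mul,
            mul_nonsing_inv _ hMu, transpose_one]
  have hSpd : S.PosDef := by
    have h1 : (diagonal d).PosDef := PosDef.diagonal hd
    have h2 : IsUnit (M⁻¹) := by
      rw [Matrix.isUnit_nonsing_inv_iff]
      exact (Matrix.isUnit_iff_isUnit_det _).2 hMu
    have := h1.conjTranspose_mul_mul_same (mulVec_injective_of_isUnit h2)
    rwa [conjTranspose_eq_transpose_of_trivial] at this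
  have hSA : IsUnit (bAA A S).det :=
    (hSpd.submatrix Subtype.val_injective).det_pos.ne'.isUnit
  have hSdet : S.det = (diagonal d).det := by
    rw [hSdef, det_mul, det_mul, det_transpose, det_nonsing_inv, hdet]
    simp
  have hblk : fromBlocks (bAA A S) (bAB A S) (bBA A S) (bBB A S) *
      fromBlocks (bAA A K) (bAB A K) (bBA A K) (bBB A K) = 1 := by
    rw [blocks_eq, blocks_eq, submatrix_mul_equiv, hSK, submatrix_one_equiv]
  obtain ⟨k1, k2⟩ := schur _ _ _ _ _ _ _ _ hblk hSA
  rw [blocks_eq, det_submatrix_equiv_self, hSdet] at k2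
  set N := 1 - bBB A G with hN
  have hMB : bBB A M = N := one_block A G
  have hMA : bBA A M = -(N * Q) := by
    rw [hQ]
    ext i j
    have : i.1 ≠ j.1 := fun h => i.2 (h ▸ j.2)
    simp [hM, this]
  have hK22 : bBB A K = N * X * Nᵀ := by
    have e1 : bBB A K = bBA A M * diagonal (fun i : {x // x ∈ A} => (d i)⁻¹) * (bBA A M)ᵀ +
        bBB A M * diagonal (fun i : {x // ¬ x ∈ A} => (d i)⁻¹) * (bBB A M)ᵀ := by
      ext i j
      change K i.1 j.1 = _
      rw [hK, Matrix.add_apply, Matrix.mul_apply, Matrix.mul_apply, Matrix.mul_apply]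
      simp only [mul_diagonal, transpose_apply, submatrix_apply]
      rw [← (Equiv.sumCompl (· ∈ A)).sum_comp, Fintype.sum_sum_type]
      rfl
    rw [e1, hMB, hMA, hX]
    simp only [transpose_neg, transpose_mul, Matrix.mul_add, Matrix.add_mul, Matrix.neg_mul,
      Matrix.mul_neg, neg_neg, Matrix.mul_assoc]
    abel
  have hKdet : (bBB A K).det = X.det := by
    rw [hK22, det_mul, det_mul, det_transpose, hdetB]; ring
  rw [hKdet] at k2
  refine ⟨k2, ?_⟩
  intro u v pu pv hpu hpv
  have hNu : IsUnit N.det := by rw [hdetB]; exact isUnit_one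
  have := (bAA A S).invertibleOfIsUnitDet hSA
  have e2 : augMatrix A S u v = fromBlocks (of fun _ _ => S u v) (of fun _ j => S u j.1)
      (of fun i _ => S i.1 v) (bAA A S) := by
    ext (i | i) (j | j) <;> rfl
  have e3 : (bBB A S - bBA A S * (bAA A S)⁻¹ * bAB A S) = (Nᵀ)⁻¹ * X⁻¹ * N⁻¹ := by
    rw [← Matrix.inv_eq_left_inv k1, hK22, Matrix.mul_inv_rev, Matrix.mul_inv_rev,
      Matrix.mul_assoc]
  have hcol : ∀ (w : {x // ¬ x ∈ A}) (q : {x // ¬ x ∈ A} → ℝ), N *ᵥ q = Pi.single w 1 →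
      ∀ i, N⁻¹ i w = q i := by
    intro w q hq i
    have : q = N⁻¹ *ᵥ Pi.single w 1 := by
      rw [← hq, mulVec_mulVec, nonsing_inv_mul _ hNu, one_mulVec]
    rw [this, mulVec_single_one]
    rfl
  rw [e2, det_fromBlocks₂₂, k2, det_unique (n := Unit), invOf_eq_nonsing_inv]
  congr 1
  have e4 := congrFun (congrFun e3 u) v
  have e5 : ((Nᵀ)⁻¹ * X⁻¹ * N⁻¹) u v = pu ⬝ᵥ (X⁻¹ *ᵥ pv) := by
    rw [Matrix.mul_assoc, ← transpose_nonsing_inv]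
    simp only [Matrix.mul_apply, dotProduct, mulVec, transpose_apply, hcol u pu hpu,
      hcol v pv hpv]
  rw [← e5, ← e4]
  simp [Matrix.mul_apply, Matrix.sub_apply]

theorem sign_comm {n : Type} [Fintype n] [DecidableEq n] (X : Matrix n n ℝ) (s : n → ℝ)
    (hs : ∀ i, s i * s i = 1) (h : ∀ i j, X i j ≠ 0 → s i = s j) (p q : n → ℝ) :
    (fun i => s i * p i) ⬝ᵥ (X⁻¹ *ᵥ q) = p ⬝ᵥ (X⁻¹ *ᵥ (fun i => s i * q i)) := by
  have hss : diagonal s * diagonal s = 1 := by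
    rw [diagonal_mul_diagonal, ← diagonal_one]
    congr 1; ext i; exact hs i
  have hc : diagonal s * X * diagonal s = X := by
    ext i j
    rw [mul_diagonal, diagonal_mul]
    by_cases h0 : X i j = 0
    · simp [h0]
    · rw [← h i j h0, mul_right_comm, hs, one_mul]
  have hi : (diagonal s)⁻¹ = diagonal s := inv_eq_left_inv hss
  have hc' : diagonal s * X⁻¹ * diagonal s = X⁻¹ := by
    conv_rhs => rw [← hc, Matrix.mul_inv_rev, Matrix.mul_inv_rev, hi]
    rw [Matrix.mul_assoc]
  have hc2 : diagonal s * X⁻¹ = X⁻¹ * diagonal s := by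
    calc diagonal s * X⁻¹ = diagonal s * X⁻¹ * (diagonal s * diagonal s) := by
          rw [hss, Matrix.mul_one]
      _ = X⁻¹ * diagonal s := by rw [← Matrix.mul_assoc, hc']
  have e1 : (fun i => s i * q i) = diagonal s *ᵥ q := by
    ext i; rw [mulVec_diagonal]
  rw [e1, mulVec_mulVec, ← hc2, ← mulVec_mulVec]
  simp only [dotProduct, mulVec_diagonal]
  apply Finset.sum_congr rfl
  intro i _
  ring

end la

theorem exists_rank {U : Type} [Fintype U] (E : U → U → Prop) (hE : Acyclic E) :
    ∃ b : U → ℕ, ∀ u v, E u v → b v < b u := by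
  classical
  refine ⟨fun u => (Finset.univ.filter fun w => Relation.TransGen E u w).card, ?_⟩
  intro u v huv
  apply Finset.card_lt_card
  rw [Finset.ssubset_iff_of_subset]
  · exact ⟨v, by simpa using Relation.TransGen.single huv, by simpa using hE v⟩
  · intro w hw
    simp only [Finset.mem_filter, Finset.mem_univ, true_and] at hw ⊢
    exact Relation.TransGen.head huv hw

/-- The combinatorial core: all sign facts, for the vertices `n1`, `n2`, and `n` ranging over the
other cycle vertices. -/
theorem core {U : Type} [Fintype U] [DecidableEq U] (E : U → U → Prop)
    (hE : Acyclic E) (A : Finset U) (n1 n2 : U) (C : Set U)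
    (h1A : n1 ∉ A) (h2A : n2 ∉ A) (h12 : n1 ≠ n2) (hCA : ∀ c ∈ C, c ∉ A)
    (h1L : ¬ LL E (A : Set U) n2 n1)
    (hC : ∀ c ∈ C, (∀ s, Rch E (A : Set U) s c → ¬ LL E (A : Set U) n2 s) ∨
      (∀ s, Rch E (A : Set U) s n1 → ¬ LL E (A : Set U) c s))
    (Γ Γ' : Matrix U U ℝ) (d : U → ℝ) (hΓ : SupportedOn E Γ) (hd : ∀ u, 0 < d u)
    (hΓ' : ∀ a b : U,
      ((a, b) ∈ EA E (A : Set U) n1 n2 → Γ' a b = -Γ a b) ∧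
      ((a, b) ∉ EA E (A : Set U) n1 n2 → Γ' a b = Γ a b)) :
    let S := ((1 - Γ)⁻¹)ᵀ * diagonal d * (1 - Γ)⁻¹
    let S' := ((1 - Γ')⁻¹)ᵀ * diagonal d * (1 - Γ')⁻¹
    (subMatrixA A S').det = (subMatrixA A S).det ∧
    (augMatrix A S' n1 n2).det = -(augMatrix A S n1 n2).det ∧
    (augMatrix A S' n1 n1).det = (augMatrix A S n1 n1).det ∧
    (∀ c ∈ C, (augMatrix A S' n1 c).det = (augMatrix A S n1 c).det ∧
      (augMatrix A S' c n1).det = (augMatrix A S c n1).det) ∧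
    (∀ u v, (u = n2 ∨ u ∈ C) → (v = n2 ∨ v ∈ C) →
      (augMatrix A S' u v).det = (augMatrix A S u v).det) := by
  classical
  intro S S'
  have tops : ∀ t, t ∈ TopsA E (A : Set U) n1 n2 ↔
      Rch E (A : Set U) t n1 ∧ LL E (A : Set U) n2 t := fun t =>
    tops_iff (by simpa using h1A) (by simpa using h2A) h12
  have ea : ∀ a b, (a, b) ∈ EA E (A : Set U) n1 n2 → E a b ∧ a ∉ A ∧ b ∉ A ∧
      LL E (A : Set U) n2 a ∧ ¬ LL E (A : Set U) n2 b ∧ Rch E (A : Set U) b n1 := by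
    rintro a b ⟨e1, e2, ⟨e3, e4⟩, e5⟩
    simp only [tops] at e2 e5
    have hb : ¬ LL E (A : Set U) n2 b := fun h => e5 ⟨e4, h⟩
    refine ⟨e1, ?_, by simpa using e3, e2.2, hb, e4⟩
    rcases Relation.ReflTransGen.cases_head e2.1 with rfl | ⟨y, hy, _⟩
    · exact h1A
    · simpa using hy.2.1
  have hΓs : ∀ a b, Γ a b ≠ 0 → E a b := fun a b h => by
    by_contra h'
    exact h (hΓ a b h')
  have hΓs' : ∀ a b, Γ' a b ≠ 0 → E a b := fun a b h => by
    by_cases h' : (a, b) ∈ EA E (A : Set U) n1 n2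
    · exact (ea a b h').1
    · rw [(hΓ' a b).2 h'] at h
      exact hΓs a b h
  obtain ⟨b, hb⟩ := exists_rank E hE
  have hdet : (1 - Γ).det = 1 := det_one_sub b Γ fun i j h => hb _ _ (hΓs i j h)
  have hdet' : (1 - Γ').det = 1 := det_one_sub b Γ' fun i j h => hb _ _ (hΓs' i j h)
  have hrB : ∀ i j : {x // ¬ x ∈ A}, bBB A Γ i j ≠ 0 → b j < b i :=
    fun i j h => hb _ _ (hΓs i j h)
  have hdetB : (1 - bBB A Γ).det = 1 := det_one_sub (fun i : {x // ¬ x ∈ A} => b i) _ hrB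
  have hdetB' : (1 - bBB A Γ').det = 1 :=
    det_one_sub (fun i : {x // ¬ x ∈ A} => b i) _ fun i j h => hb _ _ (hΓs' i j h)
  have hNu : IsUnit (1 - bBB A Γ).det := by rw [hdetB]; exact isUnit_one
  -- solutions of the system with no change
  have same : ∀ (f g : {x // ¬ x ∈ A} → ℝ), (1 - bBB A Γ) *ᵥ f = g →
      (∀ i j : {x // ¬ x ∈ A}, (i.1, j.1) ∈ EA E (A : Set U) n1 n2 → f j = 0) →
      (1 - bBB A Γ') *ᵥ f = g := by
    intro f g h h0
    rw [← h, Matrix.sub_mulVec, Matrix.sub_mulVec]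
    congr 1
    ext i
    apply Finset.sum_congr rfl
    intro j _
    by_cases hij : (i.1, j.1) ∈ EA E (A : Set U) n1 n2
    · rw [h0 i j hij]; simp
    · change Γ' i j * f j = Γ i j * f j
      rw [(hΓ' _ _).2 hij]
  set Q := (1 - bBB A Γ)⁻¹ * bBA A Γ with hQdef
  have hQ : (1 - bBB A Γ) * Q = bBA A Γ := by
    rw [hQdef, ← Matrix.mul_assoc, mul_nonsing_inv _ hNu, Matrix.one_mul]
  have hQcol : ∀ a, (1 - bBB A Γ) *ᵥ (fun i => Q i a) = fun i => bBA A Γ i a := by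
    intro a
    ext i
    rw [← hQ]
    rfl
  have hQs : ∀ i a, Q i a ≠ 0 → ToA E (A : Set U) i.1 a.1 := by
    intro i a
    refine supp_lemma (fun i : {x // ¬ x ∈ A} => b i) _ hrB _ _ (hQcol a)
      (fun i => ToA E (A : Set U) i.1 a.1) ?_ ?_ i
    · intro i h
      exact ⟨i, .refl, hΓs _ _ h, by simpa using i.2, by simp⟩
    · intro i j h h'
      exact h'.of_rch (.single ⟨hΓs _ _ h, by simpa using i.2, by simpa using j.2⟩)
  have hQ' : (1 - bBB A Γ') * Q = bBA A Γ' := by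
    have e : bBA A Γ' = bBA A Γ := by
      ext i a
      refine (hΓ' _ _).2 fun h => (ea _ _ h).2.2.1 a.2
    rw [e]
    ext i a
    refine congrFun (same _ _ (hQcol a) ?_) i
    intro i j hij
    by_contra h0
    obtain ⟨e1, e2, e3, e4, e5, e6⟩ := ea _ _ hij
    have t := hQs _ _ h0
    exact e5 (LL.of_sim ⟨a, t, t.of_rch (.single ⟨e1, by simpa using e2, by simpa using e3⟩)⟩ e4)
  obtain ⟨r1, r2⟩ := main_la A Γ d hd hdet hdetB Q hQ _ rfl
  obtain ⟨r1', r2'⟩ := main_la A Γ' d hd hdet' hdetB' Q hQ' _ rfl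
  set X := diagonal (fun i : {x // ¬ x ∈ A} => (d i)⁻¹) +
      Q * diagonal (fun i : {x // x ∈ A} => (d i)⁻¹) * Qᵀ with hX
  -- signs
  let τ : U → {x // ¬ x ∈ A} → ℝ := fun w i => if LL E (A : Set U) w i.1 then -1 else 1
  have hττ : ∀ w i, τ w i * τ w i = 1 := by
    intro w i
    by_cases h : LL E (A : Set U) w i.1 <;> simp [τ, h]
  have hXτ : ∀ w i j, X i j ≠ 0 → τ w i = τ w j := by
    intro w i j h
    by_cases hij : i = j
    · rw [hij]
    rw [hX, Matrix.add_apply, diagonal_apply_ne _ hij, zero_add, Matrix.mul_apply] at h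
    obtain ⟨a, _, ha⟩ := Finset.exists_ne_zero_of_sum_ne_zero h
    rw [mul_diagonal, transpose_apply] at ha
    have s : Sim E (A : Set U) i.1 j.1 :=
      ⟨a, hQs _ _ (left_ne_zero_of_mul (left_ne_zero_of_mul ha)),
        hQs _ _ (right_ne_zero_of_mul ha)⟩
    have : LL E (A : Set U) w i.1 ↔ LL E (A : Set U) w j.1 :=
      ⟨fun h => LL.of_sim s.symm h, fun h => LL.of_sim s h⟩
    simp only [τ, this]
  let σ : {x // ¬ x ∈ A} → ℝ := fun i => if LL E (A : Set U) n2 i.1 then -1 else 1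
  have hσσ : ∀ i, σ i * σ i = 1 := hττ n2
  have hsc := sign_comm X σ hσσ (hXτ n2)
  have hsct := fun w => sign_comm X (τ w) (hττ w) (hXτ w)
  -- columns
  have hcol : ∀ u : {x // ¬ x ∈ A}, ∃ f : {x // ¬ x ∈ A} → ℝ,
      (1 - bBB A Γ) *ᵥ f = Pi.single u 1 ∧ ∀ i, f i ≠ 0 → Rch E (A : Set U) i.1 u.1 := by
    intro u
    have hf : (1 - bBB A Γ) *ᵥ ((1 - bBB A Γ)⁻¹ *ᵥ Pi.single u 1) = Pi.single u 1 := by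
      rw [mulVec_mulVec, mul_nonsing_inv _ hNu, one_mulVec]
    refine ⟨_, hf, ?_⟩
    refine supp_lemma (fun i : {x // ¬ x ∈ A} => b i) _ hrB _ _ hf
      (fun i => Rch E (A : Set U) i.1 u.1) ?_ ?_
    · intro i h
      by_cases hiu : i = u
      · rw [hiu]
      · rw [Pi.single_eq_of_ne hiu] at h
        exact absurd rfl h
    · intro i j h h'
      exact Relation.ReflTransGen.head
        ⟨hΓs _ _ h, by simpa using i.2, by simpa using j.2⟩ h'
  choose f hf hfs using hcol
  -- the column of `n1`
  have hf1 : (1 - bBB A Γ') *ᵥ (fun i => σ i * f ⟨n1, h1A⟩ i) = Pi.single ⟨n1, h1A⟩ 1 := by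
    have key : (1 - bBB A Γ') *ᵥ (fun i => σ i * f ⟨n1, h1A⟩ i) =
        fun i => σ i * ((1 - bBB A Γ) *ᵥ f ⟨n1, h1A⟩) i := by
      ext i
      rw [Matrix.sub_mulVec, Matrix.sub_mulVec, one_mulVec, one_mulVec, Pi.sub_apply,
        Pi.sub_apply, mul_sub]
      congr 1
      simp only [mulVec, dotProduct, Finset.mul_sum]
      apply Finset.sum_congr rfl
      intro j _
      change Γ' i j * _ = σ i * (Γ i j * _)
      by_cases h0 : f ⟨n1, h1A⟩ j = 0
      · simp [h0]
      have hj : Rch E (A : Set U) j.1 n1 := hfs _ _ h0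
      by_cases hij : (i.1, j.1) ∈ EA E (A : Set U) n1 n2
      · obtain ⟨e1, e2, e3, e4, e5, e6⟩ := ea _ _ hij
        rw [(hΓ' _ _).1 hij]
        simp [σ, e4, e5]
      · rw [(hΓ' _ _).2 hij]
        by_cases hg : Γ i j = 0
        · simp [hg]
        have hE' := hΓs _ _ hg
        have hst : E i.1 j.1 ∧ i.1 ∉ (A : Set U) ∧ j.1 ∉ (A : Set U) :=
          ⟨hE', by simpa using i.2, by simpa using j.2⟩
        have hiff : LL E (A : Set U) n2 i.1 ↔ LL E (A : Set U) n2 j.1 := by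
          refine ⟨fun h => ?_, fun h => LL.of_rch (.single hst) h⟩
          by_contra hn
          refine hij ⟨hE', (tops _).2 ⟨hj.head hst, h⟩, ⟨hst.2.2, hj⟩, fun h' => ?_⟩
          exact hn ((tops _).1 h').2
        simp only [σ, hiff]
        ring
    rw [key, hf]
    ext i
    by_cases hi : i = ⟨n1, h1A⟩
    · subst hi
      simp [σ, h1L]
    · simp [Pi.single_eq_of_ne hi]
  -- the other columns
  have hfo : ∀ u : {x // ¬ x ∈ A}, (u.1 = n2 ∨ u.1 ∈ C) →
      (1 - bBB A Γ') *ᵥ f u = Pi.single u 1 := by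
    intro u hu
    refine same _ _ (hf u) ?_
    intro i j hij
    by_contra h0
    obtain ⟨e1, e2, e3, e4, e5, e6⟩ := ea _ _ hij
    have hj := hfs _ _ h0
    rcases hu with hu | hu
    · exact e5 ⟨j, .refl, hu ▸ hj⟩
    · rcases hC _ hu with hu | hu
      · exact hu i.1
          (Relation.ReflTransGen.head ⟨e1, by simpa using e2, by simpa using e3⟩ hj) e4
      · exact hu j.1 e6 ⟨j, .refl, hj⟩
  have hτ : ∀ w, (fun i => τ w.1 i * f w i) = - f w := by
    intro w
    ext i
    by_cases h0 : f w i = 0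
    · simp [h0]
    · have : LL E (A : Set U) w i.1 := ⟨i, .refl, hfs _ _ h0⟩
      simp [τ, this]
  have hσ2 : (fun i => σ i * f ⟨n2, h2A⟩ i) = - f ⟨n2, h2A⟩ := hτ ⟨n2, h2A⟩
  have hσC : ∀ c (hc : c ∉ A), (∀ s, Rch E (A : Set U) s c → ¬ LL E (A : Set U) n2 s) →
      (fun i => σ i * f ⟨c, hc⟩ i) = f ⟨c, hc⟩ := by
    intro c hc h
    ext i
    by_cases h0 : f ⟨c, hc⟩ i = 0
    · simp [h0]
    · have : ¬ LL E (A : Set U) n2 i.1 := h _ (hfs _ _ h0)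
      simp [σ, this]
  have hzero : ∀ c (hc : c ∉ A), (∀ s, Rch E (A : Set U) s n1 → ¬ LL E (A : Set U) c s) →
      ∀ g : {x // ¬ x ∈ A} → ℝ, (∀ i, g i ≠ 0 → Rch E (A : Set U) i.1 n1) →
      g ⬝ᵥ (X⁻¹ *ᵥ f ⟨c, hc⟩) = 0 ∧ f ⟨c, hc⟩ ⬝ᵥ (X⁻¹ *ᵥ g) = 0 := by
    intro c hc h g hg
    have e1 : (fun i => τ c i * g i) = g := by
      ext i
      by_cases h0 : g i = 0
      · simp [h0]
      · have : ¬ LL E (A : Set U) c i.1 := h _ (hg _ h0)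
        simp [τ, this]
    have e2 := hτ ⟨c, hc⟩
    have e3 := hsct c g (f ⟨c, hc⟩)
    have e4 := hsct c (f ⟨c, hc⟩) g
    rw [e1, e2, mulVec_neg, dotProduct_neg] at e3
    rw [e1, e2, neg_dotProduct] at e4
    exact ⟨by linarith, by linarith⟩
  have hcc : ∀ p : {x // ¬ x ∈ A} → ℝ, (fun i => σ i * (σ i * p i)) = p := by
    intro p
    ext i
    rw [← mul_assoc, hσσ, one_mul]
  refine ⟨r1'.trans r1.symm, ?_, ?_, ?_, ?_⟩
  · have a1 := r2 ⟨n1, h1A⟩ ⟨n2, h2A⟩ _ _ (hf _) (hf _)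
    have a2 := r2' ⟨n1, h1A⟩ ⟨n2, h2A⟩ _ _ hf1 (hfo _ (.inl rfl))
    refine a2.trans ?_
    rw [hsc, hσ2, mulVec_neg, dotProduct_neg, mul_neg]
    exact congrArg Neg.neg a1.symm
  · have a1 := r2 ⟨n1, h1A⟩ ⟨n1, h1A⟩ _ _ (hf _) (hf _)
    have a2 := r2' ⟨n1, h1A⟩ ⟨n1, h1A⟩ _ _ hf1 hf1
    refine a2.trans ?_
    rw [hsc, hcc]
    exact a1.symm
  · intro c hc
    have a1 := r2 ⟨n1, h1A⟩ ⟨c, hCA c hc⟩ _ _ (hf _) (hf _)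
    have a2 := r2' ⟨n1, h1A⟩ ⟨c, hCA c hc⟩ _ _ hf1 (hfo _ (.inr hc))
    have b1 := r2 ⟨c, hCA c hc⟩ ⟨n1, h1A⟩ _ _ (hf _) (hf _)
    have b2 := r2' ⟨c, hCA c hc⟩ ⟨n1, h1A⟩ _ _ (hfo _ (.inr hc)) hf1
    rcases hC c hc with h | h
    · constructor
      · refine a2.trans ?_
        rw [hsc, hσC c _ h]
        exact a1.symm
      · refine b2.trans ?_
        rw [← hsc, hσC c _ h]
        exact b1.symm
    · have z1 := hzero c (hCA c hc) h (f ⟨n1, h1A⟩) (hfs _)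
      have z2 := hzero c (hCA c hc) h (fun i => σ i * f ⟨n1, h1A⟩ i)
        fun i hi => hfs _ _ (right_ne_zero_of_mul hi)
      rw [z1.1] at a1
      rw [z1.2] at b1
      rw [z2.1] at a2
      rw [z2.2] at b2
      exact ⟨a2.trans a1.symm, b2.trans b1.symm⟩
  · intro u v hu hv
    have huA : u ∉ A := by
      rcases hu with rfl | hu
      · exact h2A
      · exact hCA _ hu
    have hvA : v ∉ A := by
      rcases hv with rfl | hv
      · exact h2A
      · exact hCA _ hv
    have a1 := r2 ⟨u, huA⟩ ⟨v, hvA⟩ _ _ (hf _) (hf _)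
    have a2 := r2' ⟨u, huA⟩ ⟨v, hvA⟩ _ _ (hfo _ hu) (hfo _ hv)
    exact a2.trans a1.symm

end P15

theorem stmt15 {U : Type} [Fintype U] [DecidableEq U] (E : U → U → Prop)
    (hE : Acyclic E) (A : Finset U)
    {p : ℕ} (hp : 4 ≤ p) (cyc : Fin p ↪ U) (hA : ∀ i, cyc i ∉ (A : Set U))
    (hdc : ∀ i j : Fin p, i ≠ j →
      ((∃ w : DWalk E (cyc i) (cyc j), w.DConn (A : Set U)) ↔ cycAdj p i j))
    (Γ Γ' Δ : Matrix U U ℝ) (hΓ : SupportedOn E Γ)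
    (hΔd : Δ.IsDiag) (hΔp : ∀ u, 0 < Δ u u)
    (hΓ' : ∀ a b : U,
      ((a, b) ∈ EA E (A : Set U) (cyc ⟨0, by omega⟩) (cyc ⟨1, by omega⟩) → Γ' a b = -Γ a b) ∧
      ((a, b) ∉ EA E (A : Set U) (cyc ⟨0, by omega⟩) (cyc ⟨1, by omega⟩) → Γ' a b = Γ a b)) :
    (subMatrixA A (((1 - Γ')⁻¹)ᵀ * Δ * (1 - Γ')⁻¹)).det =
      (subMatrixA A (((1 - Γ)⁻¹)ᵀ * Δ * (1 - Γ)⁻¹)).det ∧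
    (augMatrix A (((1 - Γ')⁻¹)ᵀ * Δ * (1 - Γ')⁻¹) (cyc ⟨0, by omega⟩) (cyc ⟨1, by omega⟩)).det =
      -(augMatrix A (((1 - Γ)⁻¹)ᵀ * Δ * (1 - Γ)⁻¹) (cyc ⟨0, by omega⟩) (cyc ⟨1, by omega⟩)).det ∧
    (∀ i j : Fin p,
      ¬((i = ⟨0, by omega⟩ ∧ j = ⟨1, by omega⟩) ∨
        (i = ⟨1, by omega⟩ ∧ j = ⟨0, by omega⟩)) →
      (augMatrix A (((1 - Γ')⁻¹)ᵀ * Δ * (1 - Γ')⁻¹) (cyc i) (cyc j)).det =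
        (augMatrix A (((1 - Γ)⁻¹)ᵀ * Δ * (1 - Γ)⁻¹) (cyc i) (cyc j)).det) := by
  have hA' : ∀ i, cyc i ∉ A := fun i => by simpa using hA i
  obtain ⟨d, rfl⟩ : ∃ d : U → ℝ, Δ = Matrix.diagonal d := ⟨_, hΔd.diagonal_diag.symm⟩
  have hd : ∀ u, 0 < d u := fun u => by simpa using hΔp u
  set z : Fin p := ⟨0, by omega⟩ with hz
  set o : Fin p := ⟨1, by omega⟩ with ho
  have hzo : z ≠ o := by simp [hz, ho]
  have hinj : ∀ i j, i ≠ j → cyc i ≠ cyc j := fun i j h h' => h (cyc.injective h')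
  have hLadj : ∀ i, i ≠ o → ∀ s, P15.Rch E (A : Set U) s (cyc i) →
      P15.LL E (A : Set U) (cyc o) s → cycAdj p i o := fun i hi s h1 h2 =>
    (hdc i o hi).1 (P15.conn_of (hA i) (hA o) (hinj i o hi) h1 h2)
  have hm1 : (p - 1 + 1) % p = 0 := by
    rw [Nat.sub_add_cancel (by omega), Nat.mod_self]
  have h2m : (1 + 1) % p = 2 := Nat.mod_eq_of_lt (by omega)
  let q : Fin p := ⟨p - 1, by omega⟩
  have hqz : q ≠ z := by simp [q, hz, Fin.ext_iff]; omega
  have hqo : q ≠ o := by simp [q, ho, Fin.ext_iff]; omega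
  have hnadj : ¬ cycAdj p q o := by
    simp only [cycAdj, q, ho, hm1, h2m]
    omega
  have h1L : ¬ P15.LL E (A : Set U) (cyc o) (cyc z) := by
    intro hL
    obtain ⟨s, hs1, t, hs2, hs3⟩ := P15.of_conn (hA z) (hA q) (hinj z q hqz.symm)
      ((hdc z q hqz.symm).2 (.inr hm1))
    exact hnadj (hLadj q hqo t hs3 (P15.LL.of_conn hs2 (P15.LL.of_rch hs1 hL)))
  obtain ⟨r1, r2, r3, r4, r5⟩ := P15.core E hE A (cyc z) (cyc o) {c | ∃ i, i ≠ z ∧ i ≠ o ∧ cyc i = c}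
    (hA' z) (hA' o) (hinj z o hzo) (by rintro c ⟨i, -, -, rfl⟩; exact hA' i) h1L
    (by
      rintro c ⟨i, hi1, hi2, rfl⟩
      by_cases hiq : i = q
      · subst hiq
        exact .inl fun s h1 h2 => hnadj (hLadj q hqo s h1 h2)
      · refine .inr fun s h1 h2 => ?_
        have hadj := (hdc z i hi1.symm).1
          (P15.conn_of (hA z) (hA i) (hinj z i hi1.symm) h1 h2)
        have hi := i.2
        simp only [ne_eq, Fin.ext_iff, q, hz, ho] at hi1 hi2 hiq
        have hlt : (i.1 + 1) % p = i.1 + 1 := Nat.mod_eq_of_lt (by omega)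
        have h1m : (0 + 1) % p = 1 := Nat.mod_eq_of_lt (by omega)
        simp only [cycAdj, hz, hlt, h1m] at hadj
        omega)
    Γ Γ' d hΓ hd hΓ'
  refine ⟨r1, r2, ?_⟩
  intro i j hij
  have other : ∀ k, k ≠ z → (cyc k = cyc o ∨ cyc k ∈ {c | ∃ i, i ≠ z ∧ i ≠ o ∧ cyc i = c}) := by
    intro k hk
    by_cases hko : k = o
    · exact .inl (hko ▸ rfl)
    · exact .inr ⟨k, hk, hko, rfl⟩
  by_cases hi : i = z
  · by_cases hj : j = z
    · rw [hi, hj]; exact r3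
    · have hjo : j ≠ o := fun h => hij (.inl ⟨hi, h⟩)
      rw [hi]
      exact (r4 (cyc j) ⟨j, hj, hjo, rfl⟩).1
  · by_cases hj : j = z
    · have hio : i ≠ o := fun h => hij (.inr ⟨h, hj⟩)
      rw [hj]
      exact (r4 (cyc i) ⟨i, hi, hio, rfl⟩).2
    · exact r5 _ _ (other i hi) (other j hj)
end
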